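/- arXiv:1810.08734 — 4 statements merged into one kernel-verified Lean document; each statement's English description precedes it below -/
import Mathlib

section
/- The complete bipartite graph $K_{55,55}$ admits a perfect 1-factorisation; that is, there exists a family of 55 pairwise edge-disjoint perfect matchings of $K_{55,55}$ whose union is the entire edge set of $K_{55,55}$, such that for every two distinct perfect matchings of the family, the union of their edge sets is the edge set of a Hamilton cycle of $K_{55,55}$. -/
open SimpleGraph

/-- A family of subgraphs `F` of a graph `G` is a perfect 1-factorisation if every member is a
perfect matching, the members are pairwise edge-disjoint, their edge sets cover the whole edge
set of `G`, and the union of the edge sets of any two distinct members is the edge set of a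
Hamilton cycle of `G`. -/
def IsPerfectOneFactorisation {V ι : Type*} [DecidableEq V] (G : SimpleGraph V)
    (F : ι → G.Subgraph) : Prop :=
  (∀ i, (F i).IsPerfectMatching) ∧
  (∀ i j, i ≠ j → Disjoint (F i).edgeSet (F j).edgeSet) ∧
  (⋃ i, (F i).edgeSet) = G.edgeSet ∧
  (∀ i j, i ≠ j → ∃ (v : V) (p : G.Walk v v), p.IsHamiltonianCycle ∧
    (F i).edgeSet ∪ (F j).edgeSet = {e | e ∈ p.edges})

namespace SimpleGraph

variable {V : Type*} {G : SimpleGraph V}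

/-- The walk through the first `n + 1` terms of a sequence of consecutively adjacent vertices. -/
def walkOfSeq (c : ℕ → V) (h : ∀ k, G.Adj (c k) (c (k + 1))) : ∀ n, G.Walk (c 0) (c n)
  | 0 => .nil
  | n + 1 => (walkOfSeq c h n).concat (h n)

lemma support_walkOfSeq (c : ℕ → V) (h : ∀ k, G.Adj (c k) (c (k + 1))) (n : ℕ) :
    (walkOfSeq c h n).support = (List.range (n + 1)).map c := by
  induction n with
  | zero => simp [walkOfSeq]
  | succ n ih =>
    rw [walkOfSeq, Walk.support_concat, ih, List.range_succ (n := n + 1)]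
    simp

lemma edges_walkOfSeq (c : ℕ → V) (h : ∀ k, G.Adj (c k) (c (k + 1))) (n : ℕ) :
    (walkOfSeq c h n).edges = (List.range n).map fun k ↦ s(c k, c (k + 1)) := by
  induction n with
  | zero => simp [walkOfSeq]
  | succ n ih =>
    rw [walkOfSeq, Walk.edges_concat, ih, List.range_succ]
    simp

/-- A periodic sequence of consecutively adjacent vertices that visits every vertex within a period
equal to the number of vertices traces out a Hamiltonian cycle. -/
lemma exists_isHamiltonianCycle_of_seq [Fintype V] [DecidableEq V] {c : ℕ → V} {n : ℕ}
    (h : ∀ k, G.Adj (c k) (c (k + 1))) (hper : c n = c 0) (hn : n = Fintype.card V) (hn3 : 3 ≤ n)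
    (hsurj : ∀ v, ∃ k < n, c (k + 1) = v) :
    ∃ p : G.Walk (c 0) (c 0), p.IsHamiltonianCycle ∧
      ∀ e, e ∈ p.edges ↔ ∃ k < n, s(c k, c (k + 1)) = e := by
  have hsupp : ((walkOfSeq c h n).copy rfl hper).support.tail =
      (List.range n).map fun k ↦ c (k + 1) := by
    rw [Walk.support_copy, support_walkOfSeq, List.range_succ_eq_map]
    simp
  have hlen : ((walkOfSeq c h n).copy rfl hper).length = n := by
    rw [← Walk.length_edges, Walk.edges_copy, edges_walkOfSeq]
    simp
  have hedges : ∀ e, e ∈ ((walkOfSeq c h n).copy rfl hper).edges ↔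
      ∃ k < n, s(c k, c (k + 1)) = e := by
    intro e
    rw [Walk.edges_copy, edges_walkOfSeq]
    simp
  generalize (walkOfSeq c h n).copy rfl hper = p at *
  refine ⟨p, ?_, hedges⟩
  have hbij : Function.Bijective fun k : Fin n ↦ c (k + 1) := by
    rw [Fintype.bijective_iff_surjective_and_card]
    refine ⟨fun v ↦ ?_, by simp [hn]⟩
    obtain ⟨k, hk, rfl⟩ := hsurj v
    exact ⟨⟨k, hk⟩, rfl⟩
  have hnodup : p.support.tail.Nodup := by
    rw [hsupp]
    refine List.Nodup.map_on (fun a ha b hb hab ↦ ?_) List.nodup_range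
    rw [List.mem_range] at ha hb
    exact congrArg Fin.val (@hbij.1 ⟨a, ha⟩ ⟨b, hb⟩ hab)
  have hnil : ¬ p.Nil := by
    rw [← Walk.length_eq_zero_iff]
    omega
  rw [Walk.isHamiltonianCycle_iff_isCycle_and_support_count_tail_eq_one]
  refine ⟨?_, fun v ↦ List.count_eq_one_of_mem hnodup ?_⟩
  · rw [Walk.isCycle_iff_isPath_tail_and_le_length, Walk.isPath_def,
      Walk.support_tail_of_not_nil _ hnil]
    exact ⟨hnodup, by omega⟩
  · obtain ⟨k, hk, rfl⟩ := hsurj v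
    rw [hsupp, List.mem_map]
    exact ⟨k, List.mem_range.2 hk, rfl⟩

end SimpleGraph

section Bipartite

variable {ι α β : Type*}

/-- The perfect matching of a complete bipartite graph given by a bijection between its parts. -/
def Equiv.matchingSubgraph (σ : α ≃ β) : (completeBipartiteGraph α β).Subgraph where
  verts := _root_.Set.univ
  Adj u v := ∃ x, u = .inl x ∧ v = .inr (σ x) ∨ v = .inl x ∧ u = .inr (σ x)
  adj_sub := by
    rintro u v ⟨x, ⟨rfl, rfl⟩ | ⟨rfl, rfl⟩⟩ <;> simp
  edge_vert _ := _root_.Set.mem_univ _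
  symm := ⟨fun _ _ ⟨x, hx⟩ ↦ ⟨x, hx.symm⟩⟩

lemma Equiv.isPerfectMatching_matchingSubgraph (σ : α ≃ β) :
    σ.matchingSubgraph.IsPerfectMatching := by
  refine ⟨?_, fun _ ↦ _root_.Set.mem_univ _⟩
  rintro (x | y) -
  · refine ⟨.inr (σ x), ⟨x, by simp⟩, ?_⟩
    rintro _ ⟨x', ⟨h, rfl⟩ | ⟨_, h⟩⟩ <;> simp_all
  · refine ⟨.inl (σ.symm y), ⟨σ.symm y, by simp⟩, ?_⟩
    rintro _ ⟨x', ⟨h, _⟩ | ⟨rfl, h⟩⟩ <;> simp_all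

lemma Equiv.mem_edgeSet_matchingSubgraph (σ : α ≃ β) (e : Sym2 (α ⊕ β)) :
    e ∈ σ.matchingSubgraph.edgeSet ↔ ∃ x, s(.inl x, .inr (σ x)) = e := by
  induction e with
  | h u v =>
    rw [Subgraph.mem_edgeSet]
    change (∃ x, _ ∨ _) ↔ _
    refine exists_congr fun x ↦ ?_
    rw [Sym2.eq_iff]
    grind

/-- If `σ` and `τ` are bijections between the parts of a complete bipartite graph such that `τ⁻¹ σ`
is transitive, then the union of the associated matchings is a Hamiltonian cycle. -/
lemma exists_isHamiltonianCycle_of_transitive [Fintype α] [Fintype β] [DecidableEq α]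
    [DecidableEq β] (σ τ : α ≃ β) (x : α) (hcard : 2 ≤ Fintype.card α)
    (hper : (fun y ↦ τ.symm (σ y))^[Fintype.card α] x = x)
    (hsurj : ∀ y, ∃ k < Fintype.card α, (fun y ↦ τ.symm (σ y))^[k] x = y) :
    ∃ (v : α ⊕ β) (p : (completeBipartiteGraph α β).Walk v v), p.IsHamiltonianCycle ∧
      σ.matchingSubgraph.edgeSet ∪ τ.matchingSubgraph.edgeSet = {e | e ∈ p.edges} := by
  set g : α → α := fun y ↦ τ.symm (σ y) with hg
  set n := Fintype.card α with hn
  have hτ (k : ℕ) : τ (g^[k + 1] x) = σ (g^[k] x) := by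
    rw [Function.iterate_succ_apply', hg, Equiv.apply_symm_apply]
  let c : ℕ → α ⊕ β := fun m ↦
    if Even m then .inl (g^[m / 2] x) else .inr (σ (g^[m / 2] x))
  have hceven (k : ℕ) : c (2 * k) = .inl (g^[k] x) := by simp [c]
  have hcodd (k : ℕ) : c (2 * k + 1) = .inr (σ (g^[k] x)) := by
    have : (2 * k + 1) / 2 = k := by omega
    simp [c, this]
  have hceven' (k : ℕ) : c (2 * k + 1 + 1) = .inl (g^[k + 1] x) := hceven (k + 1)
  have hadj (m : ℕ) : (completeBipartiteGraph α β).Adj (c m) (c (m + 1)) := by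
    obtain ⟨k, rfl | rfl⟩ := m.even_or_odd'
    · simp [hceven, hcodd]
    · simp [hceven', hcodd]
  have hsurj' (y : α) : ∃ k < n, g^[k + 1] x = y := by
    obtain ⟨k, hk, rfl⟩ := hsurj y
    rcases k with _ | k
    · exact ⟨n - 1, by omega, by rw [Nat.sub_add_cancel (by omega), hper]; rfl⟩
    · exact ⟨k, by omega, rfl⟩
  have hcard' : 2 * n = Fintype.card (α ⊕ β) := by
    rw [Fintype.card_sum, ← Fintype.card_congr σ, two_mul]
  obtain ⟨p, hp, he⟩ := exists_isHamiltonianCycle_of_seq (n := 2 * n) hadj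
    (by rw [hceven, hper]; exact (hceven 0).symm) hcard' (by omega) (by
      rintro (y | z)
      · obtain ⟨k, hk, rfl⟩ := hsurj' y
        exact ⟨2 * k + 1, by omega, hceven' k⟩
      · obtain ⟨k, hk, hz⟩ := hsurj (σ.symm z)
        exact ⟨2 * k, by omega, by rw [hcodd, hz, Equiv.apply_symm_apply]⟩)
  refine ⟨c 0, p, hp, ?_⟩
  ext e
  rw [Set.mem_union, Equiv.mem_edgeSet_matchingSubgraph, Equiv.mem_edgeSet_matchingSubgraph,
    Set.mem_ofPred_eq, he]
  constructor
  · rintro (⟨y, rfl⟩ | ⟨y, rfl⟩)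
    · obtain ⟨k, hk, rfl⟩ := hsurj y
      exact ⟨2 * k, by omega, by rw [hceven, hcodd]⟩
    · obtain ⟨k, hk, rfl⟩ := hsurj' y
      exact ⟨2 * k + 1, by omega, by rw [hceven', hcodd, hτ, Sym2.eq_swap]⟩
  · rintro ⟨m, hm, rfl⟩
    obtain ⟨k, rfl | rfl⟩ := m.even_or_odd'
    · exact .inl ⟨g^[k] x, by rw [hceven, hcodd]⟩
    · exact .inr ⟨g^[k + 1] x, by rw [hceven', hcodd, hτ, Sym2.eq_swap]⟩

/-- A sharply transitive family of bijections whose pairwise quotients are full cycles yields a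
perfect 1-factorisation of the complete bipartite graph. -/
theorem isPerfectOneFactorisation_matchingSubgraph [Fintype α] [Fintype β] [DecidableEq α]
    [DecidableEq β] (σ : ι → α ≃ β) (hcard : 2 ≤ Fintype.card α)
    (hσ : ∀ x, Function.Bijective fun i ↦ σ i x)
    (hcycle : ∀ i j, i ≠ j → ∃ x,
      (fun y ↦ (σ j).symm (σ i y))^[Fintype.card α] x = x ∧
      ∀ y, ∃ k < Fintype.card α, (fun y ↦ (σ j).symm (σ i y))^[k] x = y) :
    IsPerfectOneFactorisation (completeBipartiteGraph α β) fun i ↦ (σ i).matchingSubgraph := by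
  refine ⟨fun i ↦ (σ i).isPerfectMatching_matchingSubgraph, fun i j hij ↦ ?_, ?_, fun i j hij ↦ ?_⟩
  · rw [Set.disjoint_left]
    intro e hi hj
    rw [Equiv.mem_edgeSet_matchingSubgraph] at hi hj
    obtain ⟨x, rfl⟩ := hi
    obtain ⟨y, hy⟩ := hj
    obtain ⟨rfl, h⟩ : y = x ∧ σ j y = σ i x := by simpa using hy
    exact hij ((hσ y).1 h.symm)
  · refine (Set.iUnion_subset fun i ↦ Subgraph.edgeSet_subset _).antisymm fun e he ↦ ?_
    have key (x : α) (y : β) : ∃ i, ∃ z, s(.inl z, .inr (σ i z)) = s((.inl x : α ⊕ β), .inr y) := by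
      obtain ⟨i, hi⟩ := (hσ x).2 y
      exact ⟨i, x, by rw [← hi]⟩
    simp only [Set.mem_iUnion, Equiv.mem_edgeSet_matchingSubgraph]
    induction e with
    | h u v =>
      rcases u with x | x <;> rcases v with y | y
      · simp at he
      · exact key x y
      · rw [Sym2.eq_swap]
        exact key y x
      · simp at he
  · obtain ⟨x, hper, hsurj⟩ := hcycle i j hij
    exact exists_isHamiltonianCycle_of_transitive (σ i) (σ j) x hcard hper hsurj

end Bipartite

/-- A point whose minimal period under a self-map of a finite type is the size of the type has the
whole type as its orbit. -/
lemma Function.exists_iterate_eq_of_minimalPeriod_eq_card {α : Type*} [Fintype α] {g : α → α}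
    {x : α} (h : Function.minimalPeriod g x = Fintype.card α) (y : α) :
    ∃ k < Fintype.card α, g^[k] x = y := by
  have hbij : Function.Bijective fun k : Fin (Fintype.card α) ↦ g^[k] x := by
    rw [Fintype.bijective_iff_injective_and_card]
    refine ⟨fun a b hab ↦ Fin.ext ?_, by simp⟩
    exact Function.iterate_injOn_Iio_minimalPeriod (f := g) (x := x) (by simp [h]) (by simp [h]) hab
  obtain ⟨k, hk⟩ := hbij.2 y
  exact ⟨k, k.2, hk⟩

lemma Function.minimalPeriod_eq_fiftyFive {α : Type*} {g : α → α} {x : α}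
    (h : g^[55] x = x) (h5 : g^[5] x ≠ x) (h11 : g^[11] x ≠ x) :
    Function.minimalPeriod g x = 55 := by
  have hdvd : Function.minimalPeriod g x ∣ 55 := Function.IsPeriodicPt.minimalPeriod_dvd h
  have hmem : Function.minimalPeriod g x ∈ Nat.divisors 55 := by simp [hdvd]
  have hdiv : Nat.divisors 55 = {1, 5, 11, 55} := by decide +kernel
  have hper : g^[Function.minimalPeriod g x] x = x := Function.iterate_minimalPeriod
  rw [hdiv] at hmem
  simp only [Finset.mem_insert, Finset.mem_singleton] at hmem
  rcases hmem with hm | hm | hm | hm <;> rw [hm] at hper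
  · exact absurd (Function.iterate_fixed hper 5) h5
  · exact absurd hper h5
  · exact absurd hper h11
  · exact hm

/-- An orthomorphism of the cyclic group of order 55. -/
def orthomorphism55Fun (x : Fin 55) : Fin 55 :=
  ([31, 54, 41, 53, 26, 5, 2, 4, 10, 46, 50, 25, 33, 32, 37, 1, 15, 8, 21,
    51, 0, 45, 34, 12, 42, 30, 20, 14, 38, 19, 36, 9, 52, 48, 47, 39, 44, 18,
    17, 40, 28, 13, 49, 35, 27, 16, 7, 3, 22, 11, 43, 24, 6, 23, 29] : List (Fin 55)).getD x 0

/-- The inverse of `orthomorphism55Fun`. -/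
def orthomorphism55Inv (x : Fin 55) : Fin 55 :=
  ([20, 15, 6, 47, 7, 5, 52, 46, 17, 31, 8, 49, 23, 41, 27, 16, 45, 38, 37,
    29, 26, 18, 48, 53, 51, 11, 4, 44, 40, 54, 25, 0, 13, 12, 22, 43, 30, 14,
    28, 35, 39, 2, 24, 50, 36, 21, 9, 34, 33, 42, 10, 19, 32, 3, 1] : List (Fin 55)).getD x 0

/-- `orthomorphism55Fun` as a permutation. -/
def orthomorphism55 : Equiv.Perm (Fin 55) where
  toFun := orthomorphism55Fun
  invFun := orthomorphism55Inv
  left_inv := by unfold Function.LeftInverse; decide +kernel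
  right_inv := by unfold Function.RightInverse Function.LeftInverse; decide +kernel

lemma bijective_orthomorphism55_sub :
    Function.Bijective fun x ↦ orthomorphism55 x - x := by
  rw [← Finite.injective_iff_bijective]
  unfold Function.Injective
  decide +kernel

lemma iterate_orthomorphism55_quotient : ∀ d : Fin 55, d ≠ 0 →
    (fun y ↦ orthomorphism55.symm (orthomorphism55 y - d) + d)^[55] 0 = 0 ∧
    (fun y ↦ orthomorphism55.symm (orthomorphism55 y - d) + d)^[5] 0 ≠ 0 ∧
    (fun y ↦ orthomorphism55.symm (orthomorphism55 y - d) + d)^[11] 0 ≠ 0 := by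
  decide +kernel

/-- The translates of `orthomorphism55`. -/
def orthomorphism55Translate (i : Fin 55) : Equiv.Perm (Fin 55) :=
  ((Equiv.subRight i).trans orthomorphism55).trans (Equiv.addRight i)

lemma bijective_orthomorphism55Translate (x : Fin 55) :
    Function.Bijective fun i ↦ orthomorphism55Translate i x := by
  have h : (fun i ↦ orthomorphism55Translate i x) =
      (· + x) ∘ (fun y ↦ orthomorphism55 y - y) ∘ (x - ·) := by
    funext i
    simp [orthomorphism55Translate]
    abel
  rw [h]
  exact (Equiv.addRight x).bijective.comp
    (bijective_orthomorphism55_sub.comp (Equiv.subLeft x).bijective)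

lemma iterate_orthomorphism55Translate_quotient (i j : Fin 55) (k : ℕ) :
    (fun y ↦ (orthomorphism55Translate j).symm (orthomorphism55Translate i y))^[k] i =
      (fun y ↦ orthomorphism55.symm (orthomorphism55 y - (j - i)) + (j - i))^[k] 0 + i := by
  induction k with
  | zero => simp
  | succ k ih =>
    rw [Function.iterate_succ_apply', ih, Function.iterate_succ_apply']
    simp only [orthomorphism55Translate, Equiv.symm_trans_apply, Equiv.trans_apply,
      Equiv.subRight_apply, Equiv.coe_addRight, Equiv.addRight_symm, Equiv.subRight_symm_apply,
      add_sub_cancel_right]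
    rw [add_assoc _ _ i, sub_add_cancel, sub_sub_eq_add_sub, ← sub_eq_add_neg,
      add_sub_assoc]

/-- The complete bipartite graph `K₅₅,₅₅` admits a perfect 1-factorisation into
55 perfect matchings. -/
theorem exists_perfect_one_factorisation_K55_55 :
    ∃ F : Fin 55 → (completeBipartiteGraph (Fin 55) (Fin 55)).Subgraph,
      IsPerfectOneFactorisation (completeBipartiteGraph (Fin 55) (Fin 55)) F := by
  refine ⟨_, isPerfectOneFactorisation_matchingSubgraph orthomorphism55Translate (by simp)
    bijective_orthomorphism55Translate fun i j hij ↦ ⟨i, ?_⟩⟩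
  obtain ⟨h55, h5, h11⟩ := iterate_orthomorphism55_quotient (j - i) (sub_ne_zero.2 hij.symm)
  have hper : Function.minimalPeriod
      (fun y ↦ (orthomorphism55Translate j).symm (orthomorphism55Translate i y)) i = 55 := by
    apply Function.minimalPeriod_eq_fiftyFive <;>
      rw [iterate_orthomorphism55Translate_quotient]
    · rw [h55, zero_add]
    · exact fun h ↦ h5 (add_eq_right.1 h)
    · exact fun h ↦ h11 (add_eq_right.1 h)
  have hcard : Function.minimalPeriod
      (fun y ↦ (orthomorphism55Translate j).symm (orthomorphism55Translate i y)) i =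
      Fintype.card (Fin 55) := by rw [hper, Fintype.card_fin]
  refine ⟨?_, Function.exists_iterate_eq_of_minimalPeriod_eq_card hcard⟩
  rw [← hcard, Function.iterate_minimalPeriod]
end

section
/- For every integer $n \ge 2$, if the complete graph $K_{2n}$ admits a perfect 1-factorisation, then the complete bipartite graph $K_{2n-1,2n-1}$ also admits a perfect 1-factorisation. -/
open SimpleGraph

theorem even_card_of_involutive_of_ne {α : Type*} {f : α → α} (hf : f.Involutive)
    (hne : ∀ a, f a ≠ a) (s : Finset α) (hs : ∀ a ∈ s, f a ∈ s) : Even s.card := by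
  have h : ∑ _x ∈ s, (1 : ZMod 2) = 0 :=
    Finset.sum_involution (fun a _ => f a) (fun _ _ => by decide) (fun a _ _ => hne a)
      (fun a ha => hs a ha) (fun a _ => hf a)
  rw [Finset.sum_const, nsmul_one] at h
  exact (ZMod.natCast_eq_zero_iff_even).1 h

/-- The self-map of `W` obtained from a self-map of `Option W` by redirecting to itself every
element that is sent to `none`. -/
def foldNone {W : Type*} (f : Option W → Option W) (x : W) : W :=
  (f (some x)).getD x

section FoldNone

variable {W : Type*} {f g : Option W → Option W}

theorem foldNone_eq_iff {x y : W} :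
    foldNone f x = y ↔ f (some x) = some y ∨ f (some x) = none ∧ x = y := by
  unfold foldNone
  cases f (some x) <;> simp

theorem foldNone_involutive (hf : f.Involutive) : (foldNone f).Involutive := by
  intro x
  rcases hx : f (some x) with _ | y
  · have : foldNone f x = x := by simp [foldNone, hx]
    rw [this, this]
  · have hy : f (some y) = some x := by rw [← hx, hf]
    have : foldNone f x = y := by simp [foldNone, hx]
    rw [this]
    simp [foldNone, hy]

theorem foldNone_ne (hne : ∀ x, f x ≠ x) (hne' : ∀ x, g x ≠ x)
    (hfg : ∀ x, f x ≠ g x) (x : W) : foldNone f x ≠ foldNone g x := by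
  have hfgx := hfg (some x)
  have hfx := hne (some x)
  have hgx := hne' (some x)
  unfold foldNone
  generalize f (some x) = a at *
  generalize g (some x) = b at *
  rcases a with _ | y <;> rcases b with _ | z <;> simp_all [eq_comm]

theorem eq_univ_of_foldNone_mem [Finite W] (hf : f.Involutive) (hg : g.Involutive)
    (hne : ∀ x, f x ≠ x) (hne' : ∀ x, g x ≠ x)
    (hT : ∀ T : Set (Option W), none ∈ T → (∀ x ∈ T, f x ∈ T) → (∀ x ∈ T, g x ∈ T) →
      T = Set.univ)
    {v : W} (hv : f none = some v) {S : Set W} (hvS : v ∈ S)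
    (hfS : ∀ x ∈ S, foldNone f x ∈ S) (hgS : ∀ x ∈ S, foldNone g x ∈ S) : S = Set.univ := by
  classical
  have : Fintype W := Fintype.ofFinite W
  have fold {k : Option W → Option W} (hkS : ∀ x ∈ S, foldNone k x ∈ S) (x : W) (hx : x ∈ S) :
      k (some x) = none ∨ ∃ y ∈ S, k (some x) = some y := by
    have := hkS x hx
    unfold foldNone at this
    cases h : k (some x) <;> simp_all
  obtain ⟨w, hw⟩ : ∃ w, g none = some w := Option.ne_none_iff_exists'.1 (hne' none)
  have hwS : w ∈ S := by
    by_contra hwS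
    have h₁ : Even (S.toFinset.map Function.Embedding.some).card := by
      refine even_card_of_involutive_of_ne hg hne' _ fun a ha => ?_
      simp only [Finset.mem_map, Set.mem_toFinset, Function.Embedding.some_apply] at ha ⊢
      obtain ⟨x, hx, rfl⟩ := ha
      rcases fold hgS x hx with h | ⟨y, hy, h⟩
      · have := hg (some x)
        rw [h, hw] at this
        cases this
        exact absurd hx hwS
      · exact ⟨y, hy, h.symm⟩
    have h₂ : Even (Finset.insertNone S.toFinset).card := by
      refine even_card_of_involutive_of_ne hf hne _ fun a ha => ?_
      rcases a with _ | x
      · simpa [hv] using hvS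
      · rcases fold hfS x (by simpa using ha) with h | ⟨y, hy, h⟩
        · simp [h]
        · simpa [h] using hy
    rw [Finset.card_map] at h₁
    rw [Finset.card_insertNone] at h₂
    exact (Nat.even_add_one.1 h₂) h₁
  have closed {k : Option W → Option W} (hkS : ∀ x ∈ S, foldNone k x ∈ S) {u : W}
      (hu : k none = some u) (huS : u ∈ S) (a : Option W)
      (ha : a ∈ insert none (some '' S)) : k a ∈ insert none (some '' S) := by
    rcases a with _ | x
    · simpa [hu] using huS
    · rcases fold hkS x (by simpa using ha) with h | ⟨y, hy, h⟩
      · simp [h]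
      · simpa [h] using hy
  have := hT (insert none (some '' S)) (by simp) (closed hfS hv hvS) (closed hgS hw hwS)
  refine Set.eq_univ_of_forall fun x => ?_
  have hx : some x ∈ insert none (some '' S) := this ▸ Set.mem_univ _
  simpa using hx

end FoldNone

namespace SimpleGraph

theorem IsCycles.exists_isHamiltonianCycle {V : Type*} [Finite V] [DecidableEq V]
    {H : SimpleGraph V} (hH : H.IsCycles) (hc : H.Connected) {v w : V} (hvw : H.Adj v w) :
    ∃ p : H.Walk v v, p.IsHamiltonianCycle ∧ H.edgeSet = {e | e ∈ p.edges} := by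
  classical
  have : Fintype V := Fintype.ofFinite V
  obtain ⟨p, hp, hverts⟩ := hH.exists_cycle_toSubgraph_verts_eq_connectedComponentSupp
    (c := H.connectedComponentMk v) (v := v) rfl ⟨w, hvw⟩
  have hmem (u : V) : u ∈ p.toSubgraph.verts := by
    rw [hverts]
    exact ConnectedComponent.sound (hc.preconnected u v)
  refine ⟨p, ⟨hp, hp.isPath_tail.isHamiltonian_of_mem fun u => ?_⟩, ?_⟩
  · have hu : u ∈ p.support := (p.mem_verts_toSubgraph).1 (hmem u)
    rw [p.support_tail_of_not_nil hp.not_nil]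
    rw [← p.cons_tail_support, List.mem_cons] at hu
    rcases hu with rfl | hu
    · exact Walk.end_mem_tail_support hp.not_nil
    · exact hu
  · ext e
    induction e with
    | h a b =>
      rw [mem_edgeSet, ← hp.adj_toSubgraph_iff_of_isCycles hH (hmem a) b]
      exact p.mem_edges_toSubgraph (e := s(a, b))

/-- The subgraph of the complete bipartite graph on `W ⊕ W` formed by the edges joining each `x`
on the left to `σ x` on the right. -/
def bipartiteGraphOf {W : Type*} (σ : W → W) : (completeBipartiteGraph W W).Subgraph where
  verts := Set.univ
  Adj a b := (∃ x, a = .inl x ∧ b = .inr (σ x)) ∨ ∃ x, b = .inl x ∧ a = .inr (σ x)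
  adj_sub := by rintro _ _ (⟨x, rfl, rfl⟩ | ⟨x, rfl, rfl⟩) <;> simp
  edge_vert _ := Set.mem_univ _
  symm := ⟨fun _ _ h => h.symm⟩

section BipartiteGraphOf

variable {W : Type*} {σ ρ : W → W}

@[simp]
theorem bipartiteGraphOf_adj_inl_inr {x y : W} :
    (bipartiteGraphOf σ).Adj (.inl x) (.inr y) ↔ σ x = y := by
  simp [bipartiteGraphOf, eq_comm]

@[simp]
theorem bipartiteGraphOf_adj_inr_inl {x y : W} :
    (bipartiteGraphOf σ).Adj (.inr x) (.inl y) ↔ σ y = x := by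
  simp [bipartiteGraphOf, eq_comm]

@[simp]
theorem not_bipartiteGraphOf_adj_inl_inl {x y : W} :
    ¬ (bipartiteGraphOf σ).Adj (.inl x) (.inl y) := by
  simp [bipartiteGraphOf]

@[simp]
theorem not_bipartiteGraphOf_adj_inr_inr {x y : W} :
    ¬ (bipartiteGraphOf σ).Adj (.inr x) (.inr y) := by
  simp [bipartiteGraphOf]

theorem isPerfectMatching_bipartiteGraphOf (hσ : σ.Bijective) :
    (bipartiteGraphOf σ).IsPerfectMatching := by
  rw [Subgraph.isPerfectMatching_iff]
  rintro (x | y)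
  · exact ⟨.inr (σ x), by simp, by rintro (z | z) <;> simp [eq_comm]⟩
  · obtain ⟨x, rfl⟩ := hσ.surjective y
    exact ⟨.inl x, by simp, by rintro (z | z) <;> simp [hσ.injective.eq_iff]⟩

theorem disjoint_edgeSet_bipartiteGraphOf (h : ∀ x, σ x ≠ ρ x) :
    Disjoint (bipartiteGraphOf σ).edgeSet (bipartiteGraphOf ρ).edgeSet := by
  rw [Set.disjoint_left]
  intro e
  induction e with
  | h a b =>
    rw [Subgraph.mem_edgeSet, Subgraph.mem_edgeSet]
    rcases a with x | x <;> rcases b with y | y <;> simp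
    · rintro rfl
      exact (h x).symm
    · rintro rfl
      exact (h y).symm

theorem iUnion_edgeSet_bipartiteGraphOf {ι : Type*} {σ : ι → W → W}
    (h : ∀ x y, ∃ i, σ i x = y) :
    ⋃ i, (bipartiteGraphOf (σ i)).edgeSet = (completeBipartiteGraph W W).edgeSet := by
  ext e
  induction e with
  | h a b =>
    rw [Set.mem_iUnion]
    simp only [Subgraph.mem_edgeSet, mem_edgeSet]
    rcases a with x | x <;> rcases b with y | y <;> simp [h]

theorem isCycles_bipartiteGraphOf_sup (hσ : σ.Involutive) (hρ : ρ.Involutive)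
    (h : ∀ x, σ x ≠ ρ x) : (bipartiteGraphOf σ ⊔ bipartiteGraphOf ρ).spanningCoe.IsCycles := by
  rintro (x | x) -
  · rw [← Set.ncard_pair (Sum.inr_injective.ne (h x) : (Sum.inr (σ x) : W ⊕ W) ≠ .inr (ρ x))]
    congr 1
    ext (y | y) <;> simp [eq_comm]
  · rw [← Set.ncard_pair (Sum.inl_injective.ne (h x) : (Sum.inl (σ x) : W ⊕ W) ≠ .inl (ρ x))]
    congr 1
    ext (y | y) <;> simp [hσ.eq_iff, hρ.eq_iff, eq_comm]

theorem connected_bipartiteGraphOf_sup (hσ : σ.Involutive) (hρ : ρ.Involutive) {v : W}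
    (hv : σ v = v)
    (hS : ∀ S : Set W, v ∈ S → (∀ x ∈ S, σ x ∈ S) → (∀ x ∈ S, ρ x ∈ S) → S = Set.univ) :
    (bipartiteGraphOf σ ⊔ bipartiteGraphOf ρ).spanningCoe.Connected := by
  set H := (bipartiteGraphOf σ ⊔ bipartiteGraphOf ρ).spanningCoe with hH
  have adj_left (x : W) : H.Adj (.inl x) (.inr (σ x)) := by simp [hH]
  have adj_right (x : W) : H.Adj (.inl x) (.inr (ρ x)) := by simp [hH]
  have closed {κ : W → W} (hκ : κ.Involutive) (adj : ∀ x, H.Adj (.inl x) (.inr (κ x))) (x : W)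
      (hx : H.Reachable (.inl v) (.inl x) ∧ H.Reachable (.inl v) (.inr x)) :
      H.Reachable (.inl v) (.inl (κ x)) ∧ H.Reachable (.inl v) (.inr (κ x)) := by
    refine ⟨hx.2.trans ?_, hx.1.trans (adj x).reachable⟩
    have := adj (κ x)
    rw [hκ] at this
    exact this.symm.reachable
  have key := hS {x | H.Reachable (.inl v) (.inl x) ∧ H.Reachable (.inl v) (.inr x)}
    ⟨.rfl, by simpa [hv] using (adj_left v).reachable⟩ (closed hσ adj_left) (closed hρ adj_right)
  rw [Set.eq_univ_iff_forall] at key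
  rw [connected_iff_exists_forall_reachable]
  exact ⟨.inl v, by rintro (x | x); exacts [(key x).1, (key x).2]⟩

theorem exists_isHamiltonianCycle_bipartiteGraphOf [Finite W] [DecidableEq W]
    (hσ : σ.Involutive) (hρ : ρ.Involutive) (h : ∀ x, σ x ≠ ρ x) {v : W} (hv : σ v = v)
    (hS : ∀ S : Set W, v ∈ S → (∀ x ∈ S, σ x ∈ S) → (∀ x ∈ S, ρ x ∈ S) → S = Set.univ) :
    ∃ (u : W ⊕ W) (p : (completeBipartiteGraph W W).Walk u u), p.IsHamiltonianCycle ∧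
      (bipartiteGraphOf σ).edgeSet ∪ (bipartiteGraphOf ρ).edgeSet = {e | e ∈ p.edges} := by
  obtain ⟨p, hp, hedges⟩ := (isCycles_bipartiteGraphOf_sup hσ hρ h).exists_isHamiltonianCycle
    (connected_bipartiteGraphOf_sup hσ hρ hv hS) (v := .inl v) (w := .inr (σ v)) (by simp)
  refine ⟨.inl v, p.mapLe (Subgraph.spanningCoe_le _), hp.map Function.bijective_id, ?_⟩
  rw [Walk.edges_mapLe_eq_edges, ← hedges, Subgraph.edgeSet_spanningCoe, Subgraph.edgeSet_sup]

end BipartiteGraphOf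

/-- A set of vertices that is closed under adjacency and meets a walk contains the whole walk. -/
theorem Walk.forall_mem_support_mem_of_closed {V : Type*} {G : SimpleGraph V} {T : Set V}
    {u v : V} (p : G.Walk u v) (hT : ∀ a b, s(a, b) ∈ p.edges → a ∈ T → b ∈ T)
    {w : V} (hw : w ∈ p.support) (hwT : w ∈ T) : ∀ x ∈ p.support, x ∈ T := by
  induction p generalizing w with
  | nil => simp_all
  | @cons a b c hab p ih =>
    have hab' : a ∈ T ↔ b ∈ T :=
      ⟨hT a b (by simp), hT b a (by simp [Sym2.eq_swap])⟩
    have ih' {w : V} := ih (w := w) fun a b hab => hT a b (by simp [hab])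
    have hb : b ∈ T := by
      rcases List.mem_cons.1 hw with rfl | hw
      · exact hab'.1 hwT
      · exact ih' hw hwT b p.start_mem_support
    intro x hx
    rcases List.mem_cons.1 hx with rfl | hx
    · exact hab'.2 hb
    · exact ih' p.start_mem_support hb x hx

end SimpleGraph

theorem IsPerfectOneFactorisation.exists_completeBipartiteGraph {V W ι : Type*} [DecidableEq V]
    [Finite W] [DecidableEq W] (e : V ≃ Option W) {F : ι → (completeGraph V).Subgraph}
    (hF : IsPerfectOneFactorisation (completeGraph V) F) :
    ∃ F' : ι → (completeBipartiteGraph W W).Subgraph,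
      IsPerfectOneFactorisation (completeBipartiteGraph W W) F' := by
  obtain ⟨hmatch, hdisj, hcover, hham⟩ := hF
  choose τ hτ hτu using fun i v => Subgraph.isPerfectMatching_iff.1 (hmatch i) v
  have adj_iff (i : ι) (v w : V) : (F i).Adj v w ↔ τ i v = w :=
    ⟨fun h => (hτu i v w h).symm, fun h => h ▸ hτ i v⟩
  let f (i : ι) (x : Option W) : Option W := e (τ i (e.symm x))
  have f_invol (i : ι) : (f i).Involutive := fun x => by
    have : τ i (τ i (e.symm x)) = e.symm x := (adj_iff i _ _).1 (hτ i _).symm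
    simp [f, this]
  have f_ne (i : ι) (x : Option W) : f i x ≠ x := fun h =>
    (hτ i (e.symm x)).ne (e.eq_symm_apply.2 h).symm
  have f_ne_f (i j : ι) (hij : i ≠ j) (x : Option W) : f i x ≠ f j x := fun h => by
    have hx : τ i (e.symm x) = τ j (e.symm x) := e.injective h
    exact Set.disjoint_left.1 (hdisj i j hij) (Subgraph.mem_edgeSet.2 (hτ i (e.symm x)))
      (Subgraph.mem_edgeSet.2 (hx ▸ hτ j (e.symm x)))
  have f_cover (x y : Option W) (hxy : x ≠ y) : ∃ i, f i x = y := by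
    have : s(e.symm x, e.symm y) ∈ ⋃ i, (F i).edgeSet := by
      rw [hcover]
      simpa using hxy
    obtain ⟨i, hi⟩ := Set.mem_iUnion.1 this
    exact ⟨i, by simp [f, (adj_iff i _ _).1 (Subgraph.mem_edgeSet.1 hi)]⟩
  have f_closed (i j : ι) (hij : i ≠ j) (T : Set (Option W)) (hT : none ∈ T)
      (hi : ∀ x ∈ T, f i x ∈ T) (hj : ∀ x ∈ T, f j x ∈ T) : T = Set.univ := by
    obtain ⟨v, p, hp, hpe⟩ := hham i j hij
    refine Set.eq_univ_of_forall fun x => ?_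
    have := p.forall_mem_support_mem_of_closed (T := e ⁻¹' T) (fun a b hab ha => ?_)
      (hp.mem_support (e.symm none)) (by simpa using hT) _ (hp.mem_support (e.symm x))
    · simpa using this
    · have hab' : s(a, b) ∈ (F i).edgeSet ∪ (F j).edgeSet := hpe ▸ hab
      rcases hab' with h | h <;> rw [Subgraph.mem_edgeSet, adj_iff] at h
      · simpa [f, h] using hi _ ha
      · simpa [f, h] using hj _ ha
  have σ_invol (i : ι) := foldNone_involutive (f_invol i)
  have σ_ne (i j : ι) (hij : i ≠ j) :=
    foldNone_ne (f_ne i) (f_ne j) (f_ne_f i j hij)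
  refine ⟨fun i => bipartiteGraphOf (foldNone (f i)),
    fun i => isPerfectMatching_bipartiteGraphOf (σ_invol i).bijective,
    fun i j hij => disjoint_edgeSet_bipartiteGraphOf (σ_ne i j hij),
    iUnion_edgeSet_bipartiteGraphOf fun x y => ?_, fun i j hij => ?_⟩
  · simp only [foldNone_eq_iff]
    by_cases hxy : x = y
    · obtain ⟨i, hi⟩ := f_cover (some x) none (by simp)
      exact ⟨i, .inr ⟨hi, hxy⟩⟩
    · obtain ⟨i, hi⟩ := f_cover (some x) (some y) (by simpa using hxy)
      exact ⟨i, .inl hi⟩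
  · obtain ⟨v, hv⟩ := Option.ne_none_iff_exists'.1 (f_ne i none)
    refine exists_isHamiltonianCycle_bipartiteGraphOf (σ_invol i) (σ_invol j) (σ_ne i j hij)
      (v := v) (foldNone_eq_iff.2 (.inr ⟨by rw [← hv, f_invol i], rfl⟩)) fun S hvS hi hj => ?_
    exact eq_univ_of_foldNone_mem (f_invol i) (f_invol j) (f_ne i) (f_ne j) (f_closed i j hij)
      hv hvS hi hj

/-- If `K₂ₙ` admits a perfect 1-factorisation (into `2n - 1` perfect matchings), then so does
the complete bipartite graph `K₂ₙ₋₁,₂ₙ₋₁`. -/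
theorem perfect_one_factorisation_completeBipartite_of_complete (n : ℕ) (hn : 2 ≤ n)
    (h : ∃ F : Fin (2 * n - 1) → (completeGraph (Fin (2 * n))).Subgraph,
      IsPerfectOneFactorisation (completeGraph (Fin (2 * n))) F) :
    ∃ F : Fin (2 * n - 1) → (completeBipartiteGraph (Fin (2 * n - 1)) (Fin (2 * n - 1))).Subgraph,
      IsPerfectOneFactorisation (completeBipartiteGraph (Fin (2 * n - 1)) (Fin (2 * n - 1))) F := by
  obtain ⟨F, hF⟩ := h
  have e : Fin (2 * n) ≃ Option (Fin (2 * n - 1)) :=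
    Fintype.equivOfCardEq (by simp only [Fintype.card_fin, Fintype.card_option]; omega)
  exact hF.exists_completeBipartiteGraph e
end

section
/- Let $t \ge 3$ and let $E$ be an even starter for $\mathbb{Z}_{2t-2}$, with $a$ and $b$ the two elements of $\{0,1,\ldots,2t-3\}$ absent from the pairs of $E$. On the vertex set $\{0,1,\ldots,2t-3\} \cup \{\infty_1, \infty_2\}$, define $F_0 = E \cup \{\{a,\infty_1\}, \{b,\infty_2\}\}$; for each $i \in \{1,\ldots,2t-3\}$ define $F_i = \sigma^i(F_0)$, where $\sigma$ is the permutation $(0,1,2,\ldots,2t-3)(\infty_1)(\infty_2)$ applied to each element of each pair; and define $M = \{\{x, x+t-1\} : x \in \{0,1,\ldots,t-2\}\} \cup \{\{\infty_1,\infty_2\}\}$. Then each of $M, F_0, F_1, \ldots, F_{2t-3}$ is a perfect matching of the complete graph on these $2t$ vertices, and together they form a 1-factorisation of that complete graph (they are pairwise edge-disjoint and their union is the entire edge set). -/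
/-- A finite set of unordered pairs of vertices is a perfect matching of the complete graph
on `V` if its pairs are non-degenerate, pairwise vertex-disjoint, and cover every vertex. -/
def IsPerfectMatchingOn {V : Type*} (F : Finset (Sym2 V)) : Prop :=
  (∀ e ∈ F, ¬ e.IsDiag) ∧
  (∀ e ∈ F, ∀ f ∈ F, e ≠ f → ∀ v : V, v ∈ e → v ∉ f) ∧
  (∀ v : V, ∃ e ∈ F, v ∈ e)

open Finset

theorem isPerfectMatchingOn_of_adj {V : Type*} {F : Finset (Sym2 V)}
    (hirr : ∀ v, s(v, v) ∉ F)
    (huniq : ∀ v w w', s(v, w) ∈ F → s(v, w') ∈ F → w = w')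
    (hex : ∀ v, ∃ w, s(v, w) ∈ F) : IsPerfectMatchingOn F := by
  refine ⟨fun e he hd => ?_, fun e he f hf hne v hve hvf => ?_, fun v => ?_⟩
  · induction e with
    | h x y =>
      rw [Sym2.mk_isDiag_iff] at hd
      subst hd
      exact hirr x he
  · obtain ⟨w, rfl⟩ := Sym2.mem_iff_exists.1 hve
    obtain ⟨w', rfl⟩ := Sym2.mem_iff_exists.1 hvf
    exact hne (by rw [huniq v w w' he hf])
  · obtain ⟨w, hw⟩ := hex v
    exact ⟨_, hw, Sym2.mem_mk_left v w⟩

theorem card_filter_sym2_mk_mem_le {G : Type*} [Fintype G] [DecidableEq G] (E : Finset (Sym2 G)) :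
    #{p : G × G | s(p.1, p.2) ∈ E} ≤ 2 * #E := by
  have hsub : ({p : G × G | s(p.1, p.2) ∈ E} : Finset (G × G)) ⊆
      E.biUnion fun e => {p : G × G | s(p.1, p.2) = e} := by
    intro p hp
    simpa using hp
  refine (card_le_card hsub).trans ?_
  rw [mul_comm]
  refine card_biUnion_le_card_mul _ _ _ fun e _ => ?_
  induction e with
  | h x y =>
    refine (card_le_card (t := {(x, y), (y, x)}) ?_).trans card_le_two
    rintro ⟨u, v⟩ h
    simpa using h

/-- If the differences of the pairs in `E` cover everything outside a set `S`, and there are just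
enough pairs to do so, then each difference occurs once and no difference lies in `S`. -/
theorem sub_notMem_and_injOn_of_cover {G : Type*} [AddGroup G] [Fintype G] [DecidableEq G]
    {E : Finset (Sym2 G)} {S : Finset G} (hcard : #S + 2 * #E ≤ Fintype.card G)
    (hcover : ∀ d ∉ S, ∃ x y, s(x, y) ∈ E ∧ x - y = d) :
    (∀ x y, s(x, y) ∈ E → x - y ∉ S) ∧
    (∀ x y x' y', s(x, y) ∈ E → s(x', y') ∈ E → x - y = x' - y' → x = x' ∧ y = y') := by
  set P : Finset (G × G) := {p : G × G | s(p.1, p.2) ∈ E} with hP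
  have hsub : Sᶜ ⊆ P.image fun p => p.1 - p.2 := by
    intro d hd
    obtain ⟨x, y, hxy, rfl⟩ := hcover d (by simpa using hd)
    exact mem_image.2 ⟨(x, y), by simpa [hP] using hxy, rfl⟩
  have hPcard : #P ≤ #Sᶜ := by
    have : #P ≤ 2 * #E := by convert card_filter_sym2_mk_mem_le E
    rw [card_compl]
    omega
  have heq := eq_of_subset_of_card_le hsub (card_image_le.trans hPcard)
  have hinj : Set.InjOn (fun p : G × G => p.1 - p.2) P :=
    card_image_iff.1 (le_antisymm card_image_le (heq ▸ hPcard))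
  refine ⟨fun x y h => ?_, fun x y x' y' h h' hd => ?_⟩
  · rw [← mem_compl, heq]
    exact mem_image.2 ⟨(x, y), by simpa [hP] using h, rfl⟩
  · have hx : (x, y) ∈ (P : Set (G × G)) := by simpa [hP] using h
    have hx' : (x', y') ∈ (P : Set (G × G)) := by simpa [hP] using h'
    simpa using hinj hx hx' hd

theorem iterate_sumMap_add_one {R W : Type*} [AddCommGroupWithOne R] (i : ℕ) :
    (Sum.map (· + 1) id : R ⊕ W → R ⊕ W)^[i] = Sum.map (· + (i : R)) id := by
  induction i with
  | zero => funext v; cases v <;> simp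
  | succ i ih =>
    rw [Function.iterate_succ', ih]
    funext v
    cases v <;> simp [add_assoc]

section Translate

variable {G : Type*} [AddCommGroup G] [DecidableEq G] (E : Finset (Sym2 G)) (a b g : G)

/-- The translate by `g` of the 1-factor obtained from the starter `E` with absent elements `a`
and `b`. -/
def translatedFactor : Finset (Sym2 (G ⊕ Fin 2)) :=
  (E.image (Sym2.map Sum.inl) ∪ {s(Sum.inl a, Sum.inr 0), s(Sum.inl b, Sum.inr 1)}).image
    (Sym2.map (Sum.map (· + g) id))

variable {E a b g}

theorem mem_translatedFactor {e : Sym2 (G ⊕ Fin 2)} : e ∈ translatedFactor E a b g ↔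
    (∃ f ∈ E, Sym2.map (fun x => Sum.inl (x + g)) f = e) ∨
      s(Sum.inl (a + g), Sum.inr 0) = e ∨ s(Sum.inl (b + g), Sum.inr 1) = e := by
  simp only [translatedFactor, mem_image, mem_union, mem_insert, mem_singleton, or_and_right,
    exists_or, exists_exists_and_eq_and, exists_eq_left, Sym2.map_map, Function.comp_def,
    Sym2.map_mk, Sum.map_inl, Sum.map_inr, id]

theorem inl_inl_mem_translatedFactor {x y : G} :
    s(Sum.inl x, Sum.inl y) ∈ translatedFactor E a b g ↔ s(x - g, y - g) ∈ E := by
  rw [mem_translatedFactor]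
  constructor
  · rintro (⟨f, hf, h⟩ | h | h)
    · induction f with
      | h u v =>
        simp only [Sym2.map_mk, Sym2.eq_iff, Sum.inl.injEq] at h
        obtain ⟨rfl, rfl⟩ | ⟨rfl, rfl⟩ := h
        · simpa using hf
        · simpa [Sym2.eq_swap] using hf
    · simp at h
    · simp at h
  · exact fun h => .inl ⟨_, h, by simp⟩

theorem inl_inr_mem_translatedFactor {x : G} {k : Fin 2} :
    s(Sum.inl x, Sum.inr k) ∈ translatedFactor E a b g ↔
      (x = a + g ∧ k = 0) ∨ (x = b + g ∧ k = 1) := by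
  rw [mem_translatedFactor]
  constructor
  · rintro (⟨f, hf, h⟩ | h | h)
    · induction f with
      | h u v => simp at h
    · left; simpa [eq_comm] using h
    · right; simpa [eq_comm] using h
  · rintro (⟨rfl, rfl⟩ | ⟨rfl, rfl⟩) <;> simp

theorem inr_inl_mem_translatedFactor {x : G} {k : Fin 2} :
    s(Sum.inr k, Sum.inl x) ∈ translatedFactor E a b g ↔
      (x = a + g ∧ k = 0) ∨ (x = b + g ∧ k = 1) := by
  rw [Sym2.eq_swap, inl_inr_mem_translatedFactor]

theorem inr_inr_notMem_translatedFactor {k l : Fin 2} :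
    s(Sum.inr k, Sum.inr l) ∉ translatedFactor E a b g := by
  rw [mem_translatedFactor]
  rintro (⟨f, hf, h⟩ | h | h)
  · induction f with
    | h u v => simp at h
  · simp at h
  · simp at h

theorem isPerfectMatchingOn_translatedFactor
    (hdiag : ∀ e ∈ E, ¬ e.IsDiag)
    (hdisj : ∀ e ∈ E, ∀ f ∈ E, e ≠ f → ∀ v : G, v ∈ e → v ∉ f) (hab : a ≠ b)
    (habsent : ∀ x : G, (∀ e ∈ E, x ∉ e) ↔ (x = a ∨ x = b)) :
    IsPerfectMatchingOn (translatedFactor E a b g) := by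
  have habs : ∀ x y, s(x, y) ∈ E → x ≠ a ∧ x ≠ b := by
    intro x y h
    rw [← not_or, ← habsent]
    exact fun h' => h' _ h (Sym2.mem_mk_left x y)
  have huniq : ∀ x y y', s(x, y) ∈ E → s(x, y') ∈ E → y = y' := by
    intro x y y' h h'
    by_contra hne
    exact hdisj _ h _ h' (fun he => hne (Sym2.congr_right.1 he)) x
      (Sym2.mem_mk_left x y) (Sym2.mem_mk_left x y')
  have hex : ∀ x, x ≠ a → x ≠ b → ∃ y, s(x, y) ∈ E := by
    intro x hxa hxb
    have := mt (habsent x).1 (by tauto)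
    push Not at this
    obtain ⟨e, he, hxe⟩ := this
    obtain ⟨y, rfl⟩ := Sym2.mem_iff_exists.1 hxe
    exact ⟨y, he⟩
  apply isPerfectMatchingOn_of_adj
  · rintro (x | k)
    · rw [inl_inl_mem_translatedFactor]
      exact fun h => hdiag _ h rfl
    · exact inr_inr_notMem_translatedFactor
  · rintro (x | k) (y | l) (y' | l') <;>
      simp only [inl_inl_mem_translatedFactor, inl_inr_mem_translatedFactor,
        inr_inl_mem_translatedFactor, inr_inr_notMem_translatedFactor, Sum.inl.injEq,
        Sum.inr.injEq, reduceCtorEq, false_imp_iff, imp_false, implies_true, not_false_eq_true]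
    · intro h h'
      simpa using huniq _ _ _ h h'
    · rintro h (⟨rfl, -⟩ | ⟨rfl, -⟩)
      · exact (habs _ _ h).1 (by simp)
      · exact (habs _ _ h).2 (by simp)
    · rintro (⟨rfl, -⟩ | ⟨rfl, -⟩) h
      · exact (habs _ _ h).1 (by simp)
      · exact (habs _ _ h).2 (by simp)
    · rintro (⟨rfl, rfl⟩ | ⟨rfl, rfl⟩) (⟨h, rfl⟩ | ⟨h, rfl⟩)
      · rfl
      · exact absurd (add_right_cancel h) hab
      · exact absurd (add_right_cancel h).symm hab
      · rfl
    · rintro (⟨rfl, rfl⟩ | ⟨rfl, rfl⟩) (⟨rfl, h⟩ | ⟨rfl, h⟩) <;> simp_all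
  · rintro (x | k)
    · by_cases hxa : x - g = a
      · exact ⟨.inr 0, inl_inr_mem_translatedFactor.2 (.inl ⟨by simp [← hxa], rfl⟩)⟩
      by_cases hxb : x - g = b
      · exact ⟨.inr 1, inl_inr_mem_translatedFactor.2 (.inr ⟨by simp [← hxb], rfl⟩)⟩
      obtain ⟨y, hy⟩ := hex _ hxa hxb
      exact ⟨.inl (y + g), inl_inl_mem_translatedFactor.2 (by simpa using hy)⟩
    · obtain rfl | rfl : k = 0 ∨ k = 1 := by omega
      · exact ⟨.inl (a + g), inr_inl_mem_translatedFactor.2 (.inl ⟨rfl, rfl⟩)⟩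
      · exact ⟨.inl (b + g), inr_inl_mem_translatedFactor.2 (.inr ⟨rfl, rfl⟩)⟩

theorem disjoint_translatedFactor
    (hinj : ∀ x y x' y', s(x, y) ∈ E → s(x', y') ∈ E → x - y = x' - y' → x = x' ∧ y = y')
    {g' : G} (hg : g ≠ g') :
    Disjoint (translatedFactor E a b g) (translatedFactor E a b g') := by
  rw [disjoint_left]
  intro e
  induction e with
  | h v w =>
    rcases v with x | k <;> rcases w with y | l
    · rw [inl_inl_mem_translatedFactor, inl_inl_mem_translatedFactor]
      intro h h'
      exact hg (sub_right_injective (hinj _ _ _ _ h h' (by abel)).1)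
    · rw [inl_inr_mem_translatedFactor, inl_inr_mem_translatedFactor]
      rintro (⟨rfl, rfl⟩ | ⟨rfl, rfl⟩) <;> simpa using hg
    · rw [inr_inl_mem_translatedFactor, inr_inl_mem_translatedFactor]
      rintro (⟨rfl, rfl⟩ | ⟨rfl, rfl⟩) <;> simpa using hg
    · exact fun h => (inr_inr_notMem_translatedFactor h).elim

end Translate

section AntipodalFactor

variable (m n : ℕ)

/-- The 1-factor joining each `x` to `x + m`, together with the pair of points at infinity. -/
def antipodalFactor : Finset (Sym2 (ZMod n ⊕ Fin 2)) :=
  (range m).image (fun x : ℕ => s(Sum.inl (x : ZMod n), Sum.inl ((x + m : ℕ) : ZMod n)))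
    ∪ {s(Sum.inr 0, Sum.inr 1)}

variable {m n}

theorem natCast_add_self_of_eq_two_mul (hn : n = 2 * m) : (m : ZMod n) + m = 0 := by
  rw [← Nat.cast_add, ← two_mul, ← hn, ZMod.natCast_self]

theorem inl_inl_mem_antipodalFactor [NeZero n] (hn : n = 2 * m) {x y : ZMod n} :
    s(Sum.inl x, Sum.inl y) ∈ antipodalFactor m n ↔ y = x + m := by
  have hm := natCast_add_self_of_eq_two_mul hn
  simp only [antipodalFactor, mem_union, mem_image, mem_range, mem_singleton, Sym2.eq_iff,
    Sum.inl.injEq, reduceCtorEq, false_and, or_false, Nat.cast_add]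
  constructor
  · rintro ⟨r, -, ⟨rfl, rfl⟩ | ⟨rfl, rfl⟩⟩
    · rfl
    · rw [add_assoc, hm, add_zero]
  · rintro rfl
    have hx := ZMod.val_lt x
    by_cases h : x.val < m
    · exact ⟨x.val, h, .inl (by simp)⟩
    · have hxr : ((x.val - m : ℕ) : ZMod n) + m = x := by
        rw [← Nat.cast_add, Nat.sub_add_cancel (by omega), ZMod.natCast_zmod_val]
      refine ⟨x.val - m, by omega, .inr ⟨?_, hxr⟩⟩
      nth_rw 2 [← hxr]
      rw [add_assoc, hm, add_zero]

theorem inl_inr_notMem_antipodalFactor {x : ZMod n} {k : Fin 2} :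
    s(Sum.inl x, Sum.inr k) ∉ antipodalFactor m n := by
  simp [antipodalFactor]

theorem inr_inl_notMem_antipodalFactor {x : ZMod n} {k : Fin 2} :
    s(Sum.inr k, Sum.inl x) ∉ antipodalFactor m n := by
  simp [antipodalFactor]

theorem inr_inr_mem_antipodalFactor {k l : Fin 2} :
    s(Sum.inr k, Sum.inr l) ∈ antipodalFactor m n ↔ k ≠ l := by
  simp [antipodalFactor]
  omega

theorem isPerfectMatchingOn_antipodalFactor [NeZero n] (hn : n = 2 * m)
    (hm : (m : ZMod n) ≠ 0) : IsPerfectMatchingOn (antipodalFactor m n) := by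
  apply isPerfectMatchingOn_of_adj
  · rintro (x | k)
    · simpa [inl_inl_mem_antipodalFactor hn] using hm
    · simp [inr_inr_mem_antipodalFactor]
  · rintro (x | k) (y | l) (y' | l') <;>
      simp only [inl_inl_mem_antipodalFactor hn, inl_inr_notMem_antipodalFactor,
        inr_inl_notMem_antipodalFactor, inr_inr_mem_antipodalFactor, Sum.inl.injEq,
        Sum.inr.injEq, reduceCtorEq, false_imp_iff, imp_false, implies_true, not_false_eq_true]
    · rintro rfl rfl
      rfl
    · omega
  · rintro (x | k)
    · exact ⟨.inl (x + m), (inl_inl_mem_antipodalFactor hn).2 rfl⟩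
    · exact ⟨.inr (k + 1), inr_inr_mem_antipodalFactor.2 (by omega)⟩

theorem disjoint_antipodalFactor_translatedFactor [NeZero n] (hn : n = 2 * m)
    {E : Finset (Sym2 (ZMod n))} (hE : ∀ x y, s(x, y) ∈ E → x - y ≠ m) (a b g : ZMod n) :
    Disjoint (antipodalFactor m n) (translatedFactor E a b g) := by
  rw [disjoint_left]
  intro e
  induction e with
  | h v w =>
    rcases v with x | k <;> rcases w with y | l
    · rw [inl_inl_mem_antipodalFactor hn, inl_inl_mem_translatedFactor]
      rintro rfl h
      exact hE _ _ (Sym2.eq_swap ▸ h) (by abel)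
    · exact fun h => (inl_inr_notMem_antipodalFactor h).elim
    · exact fun h => (inr_inl_notMem_antipodalFactor h).elim
    · exact fun _ => inr_inr_notMem_translatedFactor

theorem exists_mem_factor_of_not_isDiag [NeZero n] (hn : n = 2 * m)
    {E : Finset (Sym2 (ZMod n))}
    (hcover : ∀ d : ZMod n, d ≠ 0 → d ≠ m → ∃ x y, s(x, y) ∈ E ∧ x - y = d) (a b : ZMod n)
    {e : Sym2 (ZMod n ⊕ Fin 2)} (he : ¬ e.IsDiag) :
    e ∈ antipodalFactor m n ∨ ∃ g, e ∈ translatedFactor E a b g := by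
  have hinf : ∀ (x : ZMod n) (k : Fin 2),
      ∃ g, s(Sum.inl x, Sum.inr k) ∈ translatedFactor E a b g := by
    intro x k
    simp only [inl_inr_mem_translatedFactor]
    obtain rfl | rfl : k = 0 ∨ k = 1 := by omega
    · exact ⟨x - a, .inl (by simp)⟩
    · exact ⟨x - b, .inr (by simp)⟩
  induction e with
  | h v w =>
    rw [Sym2.mk_isDiag_iff] at he
    rcases v with x | k <;> rcases w with y | l
    · simp only [inl_inl_mem_antipodalFactor hn, inl_inl_mem_translatedFactor]
      by_cases hy : y = x + m
      · exact .inl hy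
      · obtain ⟨u, v, huv, hd⟩ := hcover (y - x)
          (fun h => he (by rw [sub_eq_zero.1 h])) (fun h => hy (by rw [← h]; abel))
        refine .inr ⟨x - v, ?_⟩
        have hu : y - (x - v) = u := by rw [← sub_add, ← hd, sub_add_cancel]
        rw [hu, sub_sub_cancel, Sym2.eq_swap]
        exact huv
    · exact .inr (hinf x l)
    · rw [Sym2.eq_swap]
      exact .inr (hinf y k)
    · exact .inl (inr_inr_mem_antipodalFactor.2 fun h => he (by rw [h]))

end AntipodalFactor

/-- Given an even starter `E` for `ℤ₂ₜ₋₂` with absent elements `a` and `b`, the 1-factors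
`M, F 0, F 1, …, F (2t-3)` obtained from it are perfect matchings of the complete graph on
the `2t` vertices `ℤ₂ₜ₋₂ ⊕ {∞₁, ∞₂}` and constitute a 1-factorisation of that complete graph:
they are pairwise edge-disjoint and their union is the entire edge set.  Here `∞₁ = Sum.inr 0`,
`∞₂ = Sum.inr 1`, and `σ` is the permutation `(0, 1, …, 2t-3)(∞₁)(∞₂)`. -/
theorem even_starter_yields_one_factorisation (t : ℕ) (ht : 3 ≤ t)
    (E : Finset (Sym2 (ZMod (2 * t - 2))))
    (hcard : E.card = t - 2)
    (hdiag : ∀ e ∈ E, ¬ e.IsDiag)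
    (hdisj : ∀ e ∈ E, ∀ f ∈ E, e ≠ f → ∀ v : ZMod (2 * t - 2), v ∈ e → v ∉ f)
    (a b : ZMod (2 * t - 2)) (hab : a ≠ b)
    (habsent : ∀ x : ZMod (2 * t - 2), (∀ e ∈ E, x ∉ e) ↔ (x = a ∨ x = b))
    (hdiff : ∀ d : ZMod (2 * t - 2), d ≠ 0 → d ≠ ((t - 1 : ℕ) : ZMod (2 * t - 2)) →
      ∃ e ∈ E, ∃ x y : ZMod (2 * t - 2), e = s(x, y) ∧ (x - y = d ∨ y - x = d)) :
    let V := ZMod (2 * t - 2) ⊕ Fin 2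
    let σ : V → V := Sum.map (· + 1) id
    let F₀ : Finset (Sym2 V) :=
      E.image (Sym2.map Sum.inl) ∪ {s(Sum.inl a, Sum.inr 0), s(Sum.inl b, Sum.inr 1)}
    let F : ℕ → Finset (Sym2 V) := fun i => F₀.image (Sym2.map (σ^[i]))
    let M : Finset (Sym2 V) :=
      (Finset.range (t - 1)).image (fun (x : ℕ) =>
        s(Sum.inl (x : ZMod (2 * t - 2)), Sum.inl ((x + (t - 1) : ℕ) : ZMod (2 * t - 2))))
        ∪ {s(Sum.inr 0, Sum.inr 1)}
    IsPerfectMatchingOn M ∧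
    (∀ i ≤ 2 * t - 3, IsPerfectMatchingOn (F i)) ∧
    (∀ i ≤ 2 * t - 3, Disjoint M (F i)) ∧
    (∀ i j, i ≤ 2 * t - 3 → j ≤ 2 * t - 3 → i ≠ j → Disjoint (F i) (F j)) ∧
    (∀ e : Sym2 V, ¬ e.IsDiag ↔ (e ∈ M ∨ ∃ i ≤ 2 * t - 3, e ∈ F i)) := by
  intro V σ F₀ F M
  have hn : 2 * t - 2 = 2 * (t - 1) := by omega
  have : NeZero (2 * t - 2) := ⟨by omega⟩
  have hm : ((t - 1 : ℕ) : ZMod (2 * t - 2)) ≠ 0 := by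
    rw [Ne, ZMod.natCast_eq_zero_iff]
    exact fun h => absurd (Nat.le_of_dvd (by omega) h) (by omega)
  have hcover : ∀ d : ZMod (2 * t - 2), d ≠ 0 → d ≠ ((t - 1 : ℕ) : ZMod (2 * t - 2)) →
      ∃ x y, s(x, y) ∈ E ∧ x - y = d := by
    intro d h0 h1
    obtain ⟨e, he, x, y, rfl, h | h⟩ := hdiff d h0 h1
    · exact ⟨x, y, he, h⟩
    · exact ⟨y, x, Sym2.eq_swap ▸ he, h⟩
  obtain ⟨hS, hinj⟩ := sub_notMem_and_injOn_of_cover (E := E)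
    (S := {0, ((t - 1 : ℕ) : ZMod (2 * t - 2))})
    (by rw [ZMod.card, hcard, card_pair hm.symm]; omega)
    (fun d hd => by simp only [mem_insert, mem_singleton, not_or] at hd; exact hcover d hd.1 hd.2)
  have hF : ∀ i, F i = translatedFactor E a b i := by
    intro i
    have hσ : σ^[i] = Sum.map (· + (i : ZMod (2 * t - 2))) id := iterate_sumMap_add_one i
    simp only [F, hσ]
    rfl
  have hM : M = antipodalFactor (t - 1) (2 * t - 2) := rfl
  have hMpm := isPerfectMatchingOn_antipodalFactor hn hm
  have hFpm : ∀ i : ℕ, IsPerfectMatchingOn (translatedFactor E a b (i : ZMod (2 * t - 2))) :=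
    fun i => isPerfectMatchingOn_translatedFactor hdiag hdisj hab habsent
  simp only [hF, hM]
  refine ⟨hMpm, fun i _ => hFpm i, fun i _ => ?_, fun i j hi hj hij => ?_,
    fun e => ⟨fun he => ?_, ?_⟩⟩
  · refine disjoint_antipodalFactor_translatedFactor hn (fun x y h hd => hS x y h ?_) a b i
    simp [hd]
  · refine disjoint_translatedFactor hinj fun h => hij ?_
    rw [ZMod.natCast_eq_natCast_iff'] at h
    rwa [Nat.mod_eq_of_lt (by omega), Nat.mod_eq_of_lt (by omega)] at h
  · refine (exists_mem_factor_of_not_isDiag hn hcover a b he).imp_right ?_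
    rintro ⟨g, hg⟩
    have := ZMod.val_lt g
    exact ⟨g.val, by omega, by rwa [ZMod.natCast_zmod_val]⟩
  · rintro (he | ⟨i, -, he⟩)
    · exact hMpm.1 e he
    · exact (hFpm i).1 e he
end

section
/- Let $E$ be the set of 26 pairs $\{\{36,17\}, \{44,12\}, \{39,45\}, \{18,35\}, \{8,50\}, \{23,15\}, \{42,32\}, \{5,46\}, \{19,49\}, \{22,37\}, \{10,6\}, \{33,30\}, \{3,41\}, \{14,21\}, \{48,43\}, \{16,52\}, \{25,34\}, \{7,38\}, \{11,31\}, \{4,2\}, \{29,28\}, \{1,27\}, \{0,40\}, \{13,24\}, \{51,26\}, \{53,20\}\}$ on $\{0,1,\ldots,53\}$. On the vertex set $\{0,1,\ldots,53\} \cup \{\infty_1,\infty_2\}$ (56 vertices), define $F_0 = E \cup \{\{9,\infty_1\}, \{47,\infty_2\}\}$; for each $i \in \{1,\ldots,53\}$ define $F_i = \sigma^i(F_0)$, where $\sigma$ is the permutation $(0,1,2,\ldots,53)(\infty_1)(\infty_2)$ applied to each element of each pair; and define $M = \{\{x, x+27\} : x \in \{0,1,\ldots,26\}\} \cup \{\{\infty_1,\infty_2\}\}$.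 Then $\{M, F_0, F_1, \ldots, F_{53}\}$ is a perfect 1-factorisation of the complete graph $K_{56}$ on these 56 vertices: each member is a perfect matching, they are pairwise edge-disjoint, their union is the entire edge set, and the union of any two distinct members is the edge set of a Hamilton cycle. -/
open SimpleGraph

/-- `s` is the edge set of a Hamilton cycle of `G`. -/
def IsHamiltonCycleEdgeSet {V : Type*} [DecidableEq V] (G : SimpleGraph V)
    (s : Set (Sym2 V)) : Prop :=
  ∃ (v : V) (p : G.Walk v v), p.IsHamiltonianCycle ∧ s = {e | e ∈ p.edges}

/-- The even starter `E` for `ℤ₅₄`. -/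
def ES : Finset (Sym2 (ZMod 54)) :=
  {s(36, 17), s(44, 12), s(39, 45), s(18, 35), s(8, 50), s(23, 15), s(42, 32),
   s(5, 46), s(19, 49), s(22, 37), s(10, 6), s(33, 30), s(3, 41), s(14, 21),
   s(48, 43), s(16, 52), s(25, 34), s(7, 38), s(11, 31), s(4, 2), s(29, 28),
   s(1, 27), s(0, 40), s(13, 24), s(51, 26), s(53, 20)}

section Generic

variable {V W : Type*}

/-- Bijections carry perfect matchings to perfect matchings. -/
theorem IsPerfectMatchingOn.image [DecidableEq W] {F : Finset (Sym2 V)}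
    (hF : IsPerfectMatchingOn F) {f : V → W} (hf : f.Bijective) :
    IsPerfectMatchingOn (F.image (Sym2.map f)) := by
  obtain ⟨hdiag, hdisj, hcov⟩ := hF
  refine ⟨?_, ?_, ?_⟩
  · intro e he
    obtain ⟨e, hF, rfl⟩ := Finset.mem_image.1 he
    rw [Sym2.isDiag_map hf.injective]
    exact hdiag e hF
  · intro e he e' he' hne v hv hv'
    obtain ⟨e, hF, rfl⟩ := Finset.mem_image.1 he
    obtain ⟨e', hF', rfl⟩ := Finset.mem_image.1 he'
    obtain ⟨x, hx, rfl⟩ := Sym2.mem_map.1 hv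
    obtain ⟨y, hy, hxy⟩ := Sym2.mem_map.1 hv'
    obtain rfl := hf.injective hxy
    exact hdisj e hF e' hF' (fun h => hne (by rw [h])) _ hx hy
  · intro v
    obtain ⟨x, rfl⟩ := hf.surjective v
    obtain ⟨e, he, hx⟩ := hcov x
    exact ⟨_, Finset.mem_image_of_mem _ he, Sym2.mem_map.2 ⟨x, hx, rfl⟩⟩

theorem IsPerfectMatchingOn.eq_of_mem {F : Finset (Sym2 V)} (hF : IsPerfectMatchingOn F)
    {e f : Sym2 V} (he : e ∈ F) (hf : f ∈ F) {v : V} (hve : v ∈ e) (hvf : v ∈ f) : e = f := by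
  by_contra hne
  exact hF.2.1 e he f hf hne v hve hvf

/-- The `m` pairs of consecutive entries of an enumeration of the vertices form a perfect
matching. -/
theorem isPerfectMatchingOn_of_sequence {F : Finset (Sym2 V)} {m : ℕ} {c : ℕ → V}
    (hcard : F.card ≤ m)
    (hmem : ∀ k < m, s(c (2 * k), c (2 * k + 1)) ∈ F)
    (hinj : ∀ i < 2 * m, ∀ j < 2 * m, c i = c j → i = j)
    (hsurj : ∀ v, ∃ i < 2 * m, c i = v) : IsPerfectMatchingOn F := by
  have hpair : ∀ k ∈ Finset.range m, ∀ l ∈ Finset.range m,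
      s(c (2 * k), c (2 * k + 1)) = s(c (2 * l), c (2 * l + 1)) → k = l := by
    intro k hk l hl h
    rw [Finset.mem_range] at hk hl
    rcases Sym2.eq_iff.1 h with ⟨h, -⟩ | ⟨h, -⟩ <;>
      have := hinj _ (by omega) _ (by omega) h <;> omega
  have hsub : ∀ e ∈ F, ∃ k < m, s(c (2 * k), c (2 * k + 1)) = e := fun e he => by
    obtain ⟨k, hk, h⟩ := Finset.surj_on_of_inj_on_of_card_le
      (fun k _ => s(c (2 * k), c (2 * k + 1)))
      (fun k hk => hmem k (Finset.mem_range.1 hk)) (fun k l hk hl => hpair k hk l hl)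
      (by simpa using hcard) e he
    exact ⟨k, Finset.mem_range.1 hk, h.symm⟩
  refine ⟨?_, ?_, ?_⟩
  · intro e he
    obtain ⟨k, hk, rfl⟩ := hsub e he
    rw [Sym2.mk_isDiag_iff]
    intro h
    have := hinj _ (by omega) _ (by omega) h
    omega
  · intro e he f hf hne v hve hvf
    obtain ⟨k, hk, rfl⟩ := hsub e he
    obtain ⟨l, hl, rfl⟩ := hsub f hf
    have hkl : k ≠ l := fun h => hne (by rw [h])
    rcases Sym2.mem_iff.1 hve with rfl | rfl <;> rcases Sym2.mem_iff.1 hvf with h | h <;>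
      have := hinj _ (by omega) _ (by omega) h <;> omega
  · intro v
    obtain ⟨i, hi, rfl⟩ := hsurj v
    refine ⟨_, hmem (i / 2) (by omega), ?_⟩
    rcases Nat.even_or_odd' i with ⟨k, rfl | rfl⟩
    · simp
    · rw [show (2 * k + 1) / 2 = k by omega]
      simp

/-- A sequence of consecutively adjacent vertices is traced by a walk. -/
theorem SimpleGraph.exists_walk_of_sequence (G : SimpleGraph V) (c : ℕ → V) (n : ℕ)
    (hadj : ∀ k < n, G.Adj (c k) (c (k + 1))) :
    ∃ p : G.Walk (c 0) (c n), p.support = (List.range (n + 1)).map c ∧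
      p.edges = (List.range n).map fun k => s(c k, c (k + 1)) := by
  induction n with
  | zero => exact ⟨.nil, by simp, by simp⟩
  | succ n ih =>
    obtain ⟨p, hs, he⟩ := ih fun k hk => hadj k (by omega)
    refine ⟨p.concat (hadj n (by omega)), ?_, ?_⟩
    · rw [Walk.support_concat, hs, List.range_succ (n := n + 1)]
      simp
    · rw [Walk.edges_concat, he, List.range_succ (n := n)]
      simp

/-- A closed sequence visiting every vertex exactly once is a Hamilton cycle of the complete
graph. -/
theorem isHamiltonCycleEdgeSet_of_sequence [DecidableEq V] {c : ℕ → V} {n : ℕ} (hn : 3 ≤ n)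
    (hclosed : c n = c 0) (hinj : ∀ i < n, ∀ j < n, c i = c j → i = j)
    (hsurj : ∀ v, ∃ i < n, c i = v) :
    IsHamiltonCycleEdgeSet (completeGraph V) {e | ∃ k < n, s(c k, c (k + 1)) = e} := by
  obtain ⟨n, rfl⟩ : ∃ m, n = m + 1 := ⟨n - 1, by omega⟩
  obtain ⟨p, hs, he⟩ := (completeGraph V).exists_walk_of_sequence c n fun k hk h => by
    have := hinj k (by omega) (k + 1) (by omega) h
    omega
  have hadj : (completeGraph V).Adj (c n) (c 0) := fun h => by
    have := hinj n (by omega) 0 (by omega) h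
    omega
  have hp : p.IsPath := by
    rw [Walk.isPath_def, hs]
    refine List.Nodup.map_on ?_ List.nodup_range
    intro i hi j hj
    exact hinj i (List.mem_range.1 hi) j (List.mem_range.1 hj)
  have hnot : s(c n, c 0) ∉ p.edges := by
    rw [he, List.mem_map]
    rintro ⟨k, hk, h⟩
    rw [List.mem_range] at hk
    rcases Sym2.eq_iff.1 h with ⟨h, -⟩ | ⟨h, h'⟩
    · have := hinj _ (by omega) _ (by omega) h
      omega
    · have := hinj _ (by omega) _ (by omega) h
      have := hinj _ (by omega) _ (by omega) h'
      omega
  refine ⟨c n, .cons hadj p, ⟨(Walk.cons_isCycle_iff _ _).2 ⟨hp, hnot⟩, ?_⟩, ?_⟩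
  · have hham : p.IsHamiltonian := hp.isHamiltonian_of_mem fun v => by
      obtain ⟨i, hi, rfl⟩ := hsurj v
      rw [hs]
      exact List.mem_map_of_mem (List.mem_range.2 hi)
    simpa [Walk.IsHamiltonian] using hham
  · ext e
    simp only [Walk.edges_cons, he, List.mem_cons, List.mem_map, List.mem_range,
      Set.mem_ofPred_eq]
    constructor
    · rintro ⟨k, hk, rfl⟩
      rcases Nat.lt_succ_iff_lt_or_eq.1 hk with hk | rfl
      · exact .inr ⟨k, hk, rfl⟩
      · exact .inl (by rw [hclosed])
    · rintro (rfl | ⟨k, hk, rfl⟩)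
      · exact ⟨n, by omega, by rw [hclosed]⟩
      · exact ⟨k, by omega, rfl⟩

/-- The sequence `c` runs through all vertices once in `2 * m` steps and returns to its start,
using alternately pairs in `A` and pairs in `B`. -/
structure IsAlternatingHamilton (A B : Finset (Sym2 V)) (m : ℕ) (c : ℕ → V) : Prop where
  even_mem : ∀ k < m, s(c (2 * k), c (2 * k + 1)) ∈ A
  odd_mem : ∀ k < m, s(c (2 * k + 1), c (2 * k + 2)) ∈ B
  closed : c (2 * m) = c 0
  inj : ∀ i < 2 * m, ∀ j < 2 * m, c i = c j → i = j
  surj : ∀ v, ∃ i < 2 * m, c i = v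

namespace IsAlternatingHamilton

variable {A B : Finset (Sym2 V)} {m : ℕ} {c : ℕ → V}

theorem image [DecidableEq W] (h : IsAlternatingHamilton A B m c) {f : V → W}
    (hf : f.Bijective) :
    IsAlternatingHamilton (A.image (Sym2.map f)) (B.image (Sym2.map f)) m (f ∘ c) where
  even_mem k hk := Finset.mem_image.2 ⟨_, h.even_mem k hk, rfl⟩
  odd_mem k hk := Finset.mem_image.2 ⟨_, h.odd_mem k hk, rfl⟩
  closed := congrArg f h.closed
  inj i hi j hj hij := h.inj i hi j hj (hf.injective hij)
  surj v := by
    obtain ⟨x, rfl⟩ := hf.surjective v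
    obtain ⟨i, hi, rfl⟩ := h.surj x
    exact ⟨i, hi, rfl⟩

theorem exists_even_mem (h : IsAlternatingHamilton A B m c) (v : V) :
    ∃ k < m, v ∈ s(c (2 * k), c (2 * k + 1)) := by
  obtain ⟨i, hi, rfl⟩ := h.surj v
  refine ⟨i / 2, by omega, ?_⟩
  rcases Nat.even_or_odd' i with ⟨k, rfl | rfl⟩
  · simp
  · rw [show (2 * k + 1) / 2 = k by omega]
    simp

theorem exists_odd_mem (h : IsAlternatingHamilton A B m c) (v : V) :
    ∃ k < m, v ∈ s(c (2 * k + 1), c (2 * k + 2)) := by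
  obtain ⟨i, hi, rfl⟩ := h.surj v
  rcases Nat.even_or_odd' i with ⟨k, rfl | rfl⟩
  · rcases k with _ | k
    · refine ⟨m - 1, by omega, ?_⟩
      rw [show 2 * (m - 1) + 2 = 2 * m by omega, h.closed]
      simp
    · exact ⟨k, by omega, by simp [mul_add]⟩
  · exact ⟨k, by omega, by simp⟩

/-- The union of two perfect matchings with an alternating Hamilton sequence is a Hamilton
cycle. -/
theorem isHamiltonCycleEdgeSet [DecidableEq V] (h : IsAlternatingHamilton A B m c)
    (hm : 2 ≤ m) (hA : IsPerfectMatchingOn A) (hB : IsPerfectMatchingOn B) :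
    IsHamiltonCycleEdgeSet (completeGraph V) ↑(A ∪ B) := by
  have hcycle := isHamiltonCycleEdgeSet_of_sequence (by omega : 3 ≤ 2 * m) h.closed h.inj h.surj
  convert hcycle using 1
  ext e
  simp only [Finset.coe_union, Set.mem_union, Finset.mem_coe, Set.mem_ofPred_eq]
  constructor
  · rintro (he | he)
    · obtain ⟨k, hk, hv⟩ := h.exists_even_mem e.out.1
      exact ⟨2 * k, by omega, hA.eq_of_mem (h.even_mem k hk) he hv (Sym2.out_fst_mem e)⟩
    · obtain ⟨k, hk, hv⟩ := h.exists_odd_mem e.out.1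
      exact ⟨2 * k + 1, by omega, hB.eq_of_mem (h.odd_mem k hk) he hv (Sym2.out_fst_mem e)⟩
  · rintro ⟨k, hk, rfl⟩
    rcases Nat.even_or_odd' k with ⟨k, rfl | rfl⟩
    · exact .inl (h.even_mem k (by omega))
    · exact .inr (h.odd_mem k (by omega))

/-- Two perfect matchings with an alternating Hamilton sequence of length at least four are
disjoint. -/
theorem disjoint (h : IsAlternatingHamilton A B m c) (hm : 2 ≤ m)
    (hA : IsPerfectMatchingOn A) (hB : IsPerfectMatchingOn B) : Disjoint A B := by
  rw [Finset.disjoint_left]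
  intro e heA heB
  obtain ⟨k, hk, hv⟩ := h.exists_even_mem e.out.1
  obtain rfl := hA.eq_of_mem (h.even_mem k hk) heA hv (Sym2.out_fst_mem e)
  have heq := hB.eq_of_mem heB (h.odd_mem k hk) (Sym2.mem_mk_right _ _) (Sym2.mem_mk_left _ _)
  rw [Sym2.eq_swap, Sym2.congr_right] at heq
  rcases (by omega : k + 1 < m ∨ 2 * k + 2 = 2 * m) with hlt | hend
  · have := h.inj _ (by omega) _ (by omega) heq
    omega
  · rw [hend, h.closed] at heq
    have := h.inj _ (by omega) _ (by omega) heq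
    omega

end IsAlternatingHamilton

end Generic

namespace EvenStarter

/-- The 56 vertices `ℤ₅₄ ⊕ {∞₁, ∞₂}`. -/
abbrev Vertex := ZMod 54 ⊕ Fin 2

/-- The permutation `(0, 1, …, 53)(∞₁)(∞₂)`. -/
def rotation : Vertex → Vertex := Sum.map (· + 1) id

/-- The starter `ES`, completed to a perfect matching. -/
def baseFactor : Finset (Sym2 Vertex) :=
  ES.image (Sym2.map Sum.inl) ∪ {s(Sum.inl 9, Sum.inr 0), s(Sum.inl 47, Sum.inr 1)}

/-- The `i`-th translate of the base factor. -/
def factor (i : ℕ) : Finset (Sym2 Vertex) := baseFactor.image (Sym2.map (rotation^[i]))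

/-- The perfect matching joining antipodal elements of `ℤ₅₄`. -/
def antipodalFactor : Finset (Sym2 Vertex) :=
  (Finset.range 27).image (fun (x : ℕ) =>
    s(Sum.inl (x : ZMod 54), Sum.inl ((x + 27 : ℕ) : ZMod 54)))
    ∪ {s(Sum.inr 0, Sum.inr 1)}

theorem rotation_iterate (i : ℕ) : rotation^[i] = Sum.map (· + (i : ZMod 54)) id := by
  induction i with
  | zero => ext (x | x) <;> simp
  | succ i ih =>
    rw [Function.iterate_succ', ih]
    ext (x | x) <;> simp [rotation, add_assoc]

theorem rotation_iterate_period : rotation^[54] = id := by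
  rw [rotation_iterate, show ((54 : ℕ) : ZMod 54) = 0 from rfl]
  ext (x | x) <;> simp

theorem bijective_rotation_iterate (i : ℕ) : (rotation^[i]).Bijective := by
  rw [rotation_iterate]
  exact Function.Bijective.sumMap (Equiv.addRight (i : ZMod 54)).bijective Function.bijective_id

theorem image_factor (i j : ℕ) :
    (factor i).image (Sym2.map (rotation^[j])) = factor (i + j) := by
  rw [factor, factor, Finset.image_image, ← Sym2.map_comp, ← Function.iterate_add, add_comm]

theorem factor_zero : factor 0 = baseFactor := by
  simp [factor]

theorem factor_add_period (i : ℕ) : factor (i + 54) = factor i := by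
  rw [factor, Function.iterate_add, rotation_iterate_period, Function.comp_id, factor]

theorem image_antipodalFactor (i : ℕ) :
    antipodalFactor.image (Sym2.map (rotation^[i])) = antipodalFactor := by
  induction i with
  | zero => simp
  | succ i ih =>
    rw [Function.iterate_succ', Sym2.map_comp, ← Finset.image_image, ih]
    decide +kernel

/-- The vertex with a given number, where `54` and `55` stand for `∞₁` and `∞₂`. -/
def vertex (x : ℕ) : Vertex := if x < 54 then .inl x else .inr (Fin.ofNat 2 (x - 54))

theorem vertex_injective {x y : ℕ} (hx : x < 56) (hy : y < 56) (h : vertex x = vertex y) :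
    x = y := by
  have key : ∀ x < 56, ∀ y < 56, vertex x = vertex y → x = y := by decide +kernel
  exact key x hx y hy h

theorem exists_vertex_eq (v : Vertex) : ∃ x < 56, vertex x = v := by
  have hbij : (fun i : Fin 56 => vertex i).Bijective :=
    (Fintype.bijective_iff_injective_and_card _).2
      ⟨fun i j hij => Fin.ext (vertex_injective i.2 j.2 hij), by simp [Vertex]⟩
  obtain ⟨i, hi⟩ := hbij.surjective v
  exact ⟨i, i.2, hi⟩

/-- Rotation by `j` in terms of vertex numbers. -/
def shift (j x : ℕ) : ℕ := if x < 54 then (x + j) % 54 else x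

theorem shift_lt {j x : ℕ} (hx : x < 56) : shift j x < 56 := by
  unfold shift
  split <;> omega

theorem rotation_iterate_vertex (j x : ℕ) : rotation^[j] (vertex x) = vertex (shift j x) := by
  rw [rotation_iterate]
  by_cases hx : x < 54
  · have := Nat.mod_lt (x + j) (show 54 > 0 by omega)
    simp [vertex, shift, hx, this]
  · simp [vertex, shift, hx]

/-- The number of the vertex matched with the vertex numbered `x` by `baseFactor`. -/
def partner (x : ℕ) : ℕ :=
  [40, 27, 4, 41, 2, 46, 10, 38, 50, 54, 6, 31, 44, 24, 21, 23, 52, 36, 35, 49, 53, 14, 37, 15,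
    13, 34, 51, 1, 29, 28, 33, 11, 42, 30, 25, 18, 17, 22, 7, 45, 0, 3, 32, 48, 12, 39, 5, 55,
    43, 19, 8, 26, 16, 20, 9, 47].getD x 0

theorem mk_partner_mem_baseFactor :
    ∀ x < 56, s(vertex x, vertex (partner x)) ∈ baseFactor := by
  decide +kernel

theorem mem_factor_of_partner {d x y : ℕ} (hd : d ≤ 54) (hx : x < 56)
    (h : partner (shift (54 - d) x) = shift (54 - d) y) : s(vertex x, vertex y) ∈ factor d := by
  refine Finset.mem_image.2 ⟨_, mk_partner_mem_baseFactor _ (shift_lt (j := 54 - d) hx), ?_⟩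
  rw [h, ← rotation_iterate_vertex, ← rotation_iterate_vertex, Sym2.map_mk,
    ← Function.iterate_add_apply, ← Function.iterate_add_apply, Nat.add_sub_cancel' hd,
    rotation_iterate_period, id, id]

/-- Hamilton cycles formed by `baseFactor`, first with `antipodalFactor` and then with
`factor 1, …, factor 27`. -/
def cycles : List (List ℕ) :=
  [[54, 9, 36, 17, 44, 12, 39, 45, 18, 35, 8, 50, 23, 15, 42, 32, 5, 46, 19, 49,
      22, 37, 10, 6, 33, 30, 3, 41, 14, 21, 48, 43, 16, 52, 25, 34, 7, 38, 11, 31,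
      4, 2, 29, 28, 1, 27, 0, 40, 13, 24, 51, 26, 53, 20, 47, 55],
    [54, 9, 51, 26, 35, 18, 37, 22, 15, 23, 38, 7, 11, 31, 34, 25, 14, 21, 0, 40,
      46, 5, 3, 41, 1, 27, 52, 16, 24, 13, 45, 39, 8, 50, 20, 53, 17, 36, 19, 49,
      44, 12, 32, 42, 4, 2, 28, 29, 30, 33, 43, 48, 55, 47, 6, 10],
    [54, 9, 40, 0, 18, 35, 32, 42, 2, 4, 6, 10, 52, 16, 23, 15, 26, 51, 21, 14,
      46, 5, 43, 48, 7, 38, 19, 49, 55, 47, 41, 3, 29, 28, 53, 20, 37, 22, 1, 27,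
      36, 17, 25, 34, 44, 12, 8, 50, 45, 39, 24, 13, 33, 30, 31, 11],
    [54, 9, 13, 24, 17, 36, 33, 30, 4, 2, 23, 15, 47, 55, 50, 8, 49, 19, 1, 27,
      16, 52, 22, 37, 28, 29, 0, 40, 25, 34, 14, 21, 38, 7, 5, 46, 51, 26, 18, 35,
      45, 39, 20, 53, 11, 31, 32, 42, 48, 43, 3, 41, 10, 6, 44, 12],
    [54, 9, 50, 8, 6, 10, 14, 21, 40, 0, 12, 44, 4, 2, 20, 53, 23, 15, 35, 18,
      25, 34, 37, 22, 39, 45, 7, 38, 29, 28, 17, 36, 46, 5, 31, 11, 42, 32, 33, 30,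
      1, 27, 19, 49, 43, 48, 16, 52, 47, 55, 51, 26, 41, 3, 24, 13],
    [54, 9, 7, 38, 35, 18, 29, 28, 20, 53, 48, 43, 12, 44, 50, 8, 46, 5, 45, 39,
      30, 33, 34, 25, 4, 2, 31, 11, 15, 23, 40, 0, 24, 13, 1, 27, 42, 32, 6, 10,
      51, 26, 19, 49, 17, 36, 16, 52, 55, 47, 37, 22, 41, 3, 21, 14],
    [54, 9, 47, 55, 53, 20, 27, 1, 25, 34, 35, 18, 50, 8, 10, 6, 46, 5, 26, 51,
      45, 39, 36, 17, 37, 22, 4, 2, 14, 21, 29, 28, 43, 48, 38, 7, 33, 30, 19, 49,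
      0, 40, 31, 11, 52, 16, 12, 44, 13, 24, 41, 3, 32, 42, 23, 15],
    [54, 9, 11, 31, 20, 53, 12, 44, 29, 28, 21, 14, 45, 39, 49, 19, 51, 26, 2, 4,
      33, 30, 22, 37, 40, 0, 55, 47, 7, 38, 18, 35, 36, 17, 13, 24, 43, 48, 10, 6,
      27, 1, 50, 8, 34, 25, 42, 32, 41, 3, 15, 23, 5, 46, 52, 16],
    [54, 9, 35, 18, 14, 21, 32, 42, 33, 30, 45, 39, 19, 49, 11, 31, 23, 15, 46, 5,
      34, 25, 44, 12, 10, 6, 24, 13, 0, 40, 50, 8, 48, 43, 26, 51, 2, 4, 16, 52,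
      20, 53, 47, 55, 1, 27, 3, 41, 38, 7, 28, 29, 22, 37, 36, 17],
    [54, 9, 49, 19, 15, 23, 30, 33, 22, 37, 38, 7, 25, 34, 43, 48, 0, 40, 20, 53,
      21, 14, 1, 27, 44, 12, 50, 8, 29, 28, 4, 2, 55, 47, 16, 52, 3, 41, 51, 26,
      45, 39, 42, 32, 24, 13, 11, 31, 46, 5, 17, 36, 10, 6, 35, 18],
    [54, 9, 30, 33, 25, 34, 23, 15, 2, 4, 53, 20, 16, 52, 42, 32, 47, 55, 3, 41,
      21, 14, 12, 44, 35, 18, 6, 10, 50, 8, 26, 51, 13, 24, 31, 11, 37, 22, 0, 40,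
      43, 48, 17, 36, 7, 38, 39, 45, 28, 29, 5, 46, 27, 1, 49, 19],
    [54, 9, 27, 1, 23, 15, 13, 24, 35, 18, 49, 19, 7, 38, 12, 44, 41, 3, 16, 52,
      14, 21, 17, 36, 45, 39, 40, 0, 5, 46, 29, 28, 47, 55, 4, 2, 50, 8, 37, 22,
      42, 32, 25, 34, 26, 51, 11, 31, 10, 6, 30, 33, 48, 43, 53, 20],
    [54, 9, 38, 7, 31, 11, 32, 42, 45, 39, 13, 24, 2, 4, 17, 36, 25, 34, 49, 19,
      50, 8, 20, 53, 15, 23, 43, 48, 29, 28, 10, 6, 1, 27, 35, 18, 22, 37, 46, 5,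
      55, 47, 30, 33, 26, 51, 3, 41, 40, 0, 44, 12, 52, 16, 14, 21],
    [54, 9, 21, 14, 40, 0, 16, 52, 4, 2, 7, 38, 47, 55, 6, 10, 39, 45, 1, 27,
      34, 25, 3, 41, 42, 32, 8, 50, 35, 18, 5, 46, 43, 48, 31, 11, 29, 28, 36, 17,
      15, 23, 19, 49, 30, 33, 12, 44, 24, 13, 53, 20, 51, 26, 37, 22],
    [54, 9, 33, 30, 12, 44, 47, 55, 7, 38, 27, 1, 17, 36, 51, 26, 4, 2, 46, 5,
      53, 20, 24, 13, 34, 25, 45, 39, 48, 43, 42, 32, 49, 19, 6, 10, 22, 37, 29, 28,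
      35, 18, 16, 52, 21, 14, 0, 40, 11, 31, 50, 8, 3, 41, 15, 23],
    [54, 9, 4, 2, 18, 35, 14, 21, 25, 34, 10, 6, 0, 40, 49, 19, 17, 36, 29, 28,
      39, 45, 48, 43, 44, 12, 41, 3, 47, 55, 8, 50, 33, 30, 38, 7, 20, 53, 22, 37,
      52, 16, 42, 32, 51, 26, 46, 5, 27, 1, 15, 23, 11, 31, 13, 24],
    [54, 9, 55, 47, 27, 1, 7, 38, 53, 20, 18, 35, 11, 31, 39, 45, 44, 12, 24, 13,
      42, 32, 14, 21, 8, 50, 41, 3, 19, 49, 46, 5, 10, 6, 28, 29, 40, 0, 23, 15,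
      36, 17, 43, 48, 4, 2, 16, 52, 33, 30, 37, 22, 26, 51, 34, 25],
    [54, 9, 22, 37, 16, 52, 35, 18, 44, 12, 36, 17, 3, 41, 30, 33, 15, 23, 27, 1,
      24, 13, 25, 34, 53, 20, 4, 2, 8, 50, 47, 55, 10, 6, 11, 31, 38, 7, 29, 28,
      48, 43, 14, 21, 19, 49, 5, 46, 45, 39, 0, 40, 32, 42, 51, 26],
    [54, 9, 3, 41, 33, 30, 8, 50, 6, 10, 23, 15, 44, 12, 7, 38, 17, 36, 53, 20,
      22, 37, 13, 24, 28, 29, 49, 19, 45, 39, 32, 42, 31, 11, 55, 47, 46, 5, 21, 14,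
      26, 51, 48, 43, 52, 16, 34, 25, 2, 4, 18, 35, 0, 40, 1, 27],
    [54, 9, 31, 11, 24, 13, 8, 50, 30, 33, 40, 0, 37, 22, 6, 10, 4, 2, 41, 3,
      26, 51, 7, 38, 14, 21, 23, 15, 27, 1, 36, 17, 35, 18, 39, 45, 16, 52, 49, 19,
      5, 46, 20, 53, 44, 12, 55, 47, 48, 43, 32, 42, 34, 25, 29, 28],
    [54, 9, 14, 21, 47, 55, 13, 24, 22, 37, 2, 4, 27, 1, 38, 7, 23, 15, 39, 45,
      0, 40, 19, 49, 48, 43, 35, 18, 36, 17, 46, 5, 11, 31, 51, 26, 30, 33, 44, 12,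
      25, 34, 41, 3, 42, 32, 10, 6, 20, 53, 50, 8, 52, 16, 28, 29],
    [54, 9, 53, 20, 41, 3, 38, 7, 21, 14, 55, 47, 18, 35, 42, 32, 52, 16, 40, 0,
      51, 26, 13, 24, 8, 50, 49, 19, 37, 22, 48, 43, 4, 2, 39, 45, 34, 25, 23, 15,
      10, 6, 12, 44, 36, 17, 29, 28, 5, 46, 1, 27, 31, 11, 33, 30],
    [54, 9, 25, 34, 12, 44, 5, 46, 35, 18, 30, 33, 53, 20, 38, 7, 13, 24, 26, 51,
      50, 8, 22, 37, 45, 39, 4, 2, 47, 55, 15, 23, 49, 19, 48, 43, 36, 17, 41, 3,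
      40, 0, 10, 6, 29, 28, 32, 42, 21, 14, 27, 1, 52, 16, 11, 31],
    [54, 9, 23, 15, 28, 29, 33, 30, 7, 38, 46, 5, 40, 0, 34, 25, 27, 1, 11, 31,
      19, 49, 20, 53, 2, 4, 41, 3, 48, 43, 22, 37, 44, 12, 17, 36, 47, 55, 16, 52,
      51, 26, 10, 6, 45, 39, 21, 14, 8, 50, 24, 13, 35, 18, 42, 32],
    [54, 9, 15, 23, 44, 12, 2, 4, 49, 19, 43, 48, 37, 22, 40, 0, 3, 41, 6, 10,
      24, 13, 18, 35, 1, 27, 11, 31, 8, 50, 21, 14, 36, 17, 55, 47, 39, 45, 38, 7,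
      46, 5, 42, 32, 20, 53, 52, 16, 29, 28, 26, 51, 25, 34, 30, 33],
    [54, 9, 32, 42, 7, 38, 49, 19, 14, 21, 33, 30, 17, 36, 2, 4, 1, 27, 29, 28,
      12, 44, 20, 53, 0, 40, 48, 43, 6, 10, 16, 52, 26, 51, 22, 37, 15, 23, 41, 3,
      13, 24, 45, 39, 46, 5, 50, 8, 47, 55, 18, 35, 31, 11, 25, 34],
    [54, 9, 48, 43, 8, 50, 39, 45, 21, 14, 4, 2, 5, 46, 25, 34, 22, 37, 3, 41,
      49, 19, 55, 47, 40, 0, 1, 27, 53, 20, 15, 23, 52, 16, 38, 7, 44, 12, 26, 51,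
      6, 10, 33, 30, 28, 29, 13, 24, 42, 32, 36, 17, 11, 31, 18, 35],
    [54, 9, 44, 12, 18, 35, 23, 15, 5, 46, 22, 37, 33, 30, 14, 21, 16, 52, 7, 38,
      4, 2, 1, 27, 13, 24, 53, 20, 55, 47, 26, 51, 40, 0, 28, 29, 31, 11, 34, 25,
      43, 48, 41, 3, 6, 10, 49, 19, 32, 42, 50, 8, 45, 39, 17, 36]]

/-- The vertex numbers along the `d`-th Hamilton cycle, continued periodically. -/
def code (d k : ℕ) : ℕ := (cycles.getD d []).getD (k % 56) 0

/-- The vertex sequence of the `d`-th Hamilton cycle, continued periodically. -/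
def cycle (d k : ℕ) : Vertex := vertex (code d k)

theorem cycle_mod (d k : ℕ) : cycle d (k % 56) = cycle d k := by
  simp [cycle, code]

theorem code_lt {d : ℕ} (hd : d < 28) (k : ℕ) : code d k < 56 := by
  have key : ∀ l ∈ cycles, ∀ x ∈ l, x < 56 := by decide +kernel
  unfold code
  rcases Nat.lt_or_ge (k % 56) (cycles.getD d []).length with h | h
  · rw [List.getD_eq_getElem _ _ h]
    refine key _ ?_ _ (List.getElem_mem h)
    rw [List.getD_eq_getElem _ _ hd]
    exact List.getElem_mem _
  · rw [List.getD_eq_default _ _ h]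
    omega

theorem cycle_injective {d : ℕ} (hd : d < 28) :
    ∀ i < 56, ∀ j < 56, cycle d i = cycle d j → i = j := by
  intro i hi j hj hij
  have key : ∀ l ∈ cycles, l.length = 56 ∧ l.Nodup := by decide +kernel
  obtain ⟨hlen, hnodup⟩ := key (cycles.getD d []) (by
    rw [List.getD_eq_getElem _ _ hd]
    exact List.getElem_mem _)
  have h := vertex_injective (code_lt hd i) (code_lt hd j) hij
  unfold code at h
  rw [Nat.mod_eq_of_lt hi, Nat.mod_eq_of_lt hj, List.getD_eq_getElem _ _ (hi.trans_eq hlen.symm),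
    List.getD_eq_getElem _ _ (hj.trans_eq hlen.symm)] at h
  exact (hnodup.getElem_inj_iff).1 h

theorem cycle_surjective {d : ℕ} (hd : d < 28) (v : Vertex) : ∃ i < 56, cycle d i = v := by
  have hbij : (fun i : Fin 56 => cycle d i).Bijective :=
    (Fintype.bijective_iff_injective_and_card _).2
      ⟨fun i j hij => Fin.ext (cycle_injective hd i i.2 j j.2 hij), by simp [Vertex]⟩
  obtain ⟨i, hi⟩ := hbij.surjective v
  exact ⟨i, i.2, hi⟩

theorem cycle_even_mem {d : ℕ} (hd : d < 28) {k : ℕ} (hk : k < 28) :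
    s(cycle d (2 * k), cycle d (2 * k + 1)) ∈ baseFactor := by
  have key : ∀ d < 28, ∀ k < 28, partner (code d (2 * k)) = code d (2 * k + 1) := by
    decide +kernel
  rw [cycle, cycle, ← key d hd k hk]
  exact mk_partner_mem_baseFactor _ (code_lt hd _)

theorem cycle_odd_mem {d : ℕ} (hpos : 0 < d) (hd : d < 28) {k : ℕ} (hk : k < 28) :
    s(cycle d (2 * k + 1), cycle d (2 * k + 2)) ∈ factor d := by
  have key : ∀ d < 27, ∀ k < 28, partner (shift (54 - (d + 1)) (code (d + 1) (2 * k + 1))) =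
      shift (54 - (d + 1)) (code (d + 1) (2 * k + 2)) := by
    decide +kernel
  obtain ⟨d, rfl⟩ : ∃ n, d = n + 1 := ⟨d - 1, by omega⟩
  exact mem_factor_of_partner (by omega) (code_lt hd _) (key d (by omega) k hk)

theorem isPerfectMatchingOn_baseFactor : IsPerfectMatchingOn baseFactor := by
  exact isPerfectMatchingOn_of_sequence (m := 28) (c := cycle 0) (by decide +kernel)
    (fun _ => cycle_even_mem (by omega)) (cycle_injective (by omega))
    (cycle_surjective (by omega))

theorem isPerfectMatchingOn_factor (i : ℕ) : IsPerfectMatchingOn (factor i) :=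
  isPerfectMatchingOn_baseFactor.image (bijective_rotation_iterate i)

theorem cycle_antipodal_mem : ∀ k < 28,
    s(cycle 0 (2 * k + 1), cycle 0 (2 * k + 2)) ∈ antipodalFactor := by
  decide +kernel

theorem isPerfectMatchingOn_antipodalFactor : IsPerfectMatchingOn antipodalFactor := by
  refine isPerfectMatchingOn_of_sequence (m := 28) (c := fun k => cycle 0 (k + 1))
    (by decide +kernel) cycle_antipodal_mem ?_ ?_
  · intro i hi j hj hij
    simp only [← cycle_mod 0 (_ + 1)] at hij
    have := cycle_injective (d := 0) (by omega) _ (by omega) _ (by omega) hij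
    omega
  · intro v
    obtain ⟨i, hi, rfl⟩ := cycle_surjective (d := 0) (by omega) v
    refine ⟨(i + 55) % 56, by omega, ?_⟩
    rw [← cycle_mod, show ((i + 55) % 56 + 1) % 56 = i by omega]

theorem isAlternatingHamilton_antipodalFactor :
    IsAlternatingHamilton baseFactor antipodalFactor 28 (cycle 0) where
  even_mem _ := cycle_even_mem (by omega)
  odd_mem := cycle_antipodal_mem
  closed := rfl
  inj := cycle_injective (by omega)
  surj := cycle_surjective (by omega)

theorem isAlternatingHamilton_factor {d : ℕ} (hpos : 0 < d) (hd : d < 28) :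
    IsAlternatingHamilton (factor 0) (factor d) 28 (cycle d) where
  even_mem _ hk := by
    rw [factor_zero]
    exact cycle_even_mem hd hk
  odd_mem _ := cycle_odd_mem hpos hd
  closed := rfl
  inj := cycle_injective hd
  surj := cycle_surjective hd

theorem exists_isAlternatingHamilton_antipodalFactor (i : ℕ) :
    ∃ c, IsAlternatingHamilton (factor i) antipodalFactor 28 c := by
  have h := isAlternatingHamilton_antipodalFactor.image (bijective_rotation_iterate i)
  rw [image_antipodalFactor] at h
  exact ⟨_, h⟩

theorem exists_isAlternatingHamilton_factor_add {d : ℕ} (hpos : 0 < d) (hd : d < 28) (i : ℕ) :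
    ∃ c, IsAlternatingHamilton (factor i) (factor (d + i)) 28 c := by
  have h := (isAlternatingHamilton_factor hpos hd).image (bijective_rotation_iterate i)
  rw [image_factor, image_factor, zero_add] at h
  exact ⟨_, h⟩

/-- Differences above `27` are reduced to smaller ones by exchanging the two factors. -/
theorem exists_isAlternatingHamilton_factor {i j : ℕ} (hij : i < j) (hj : j ≤ 53) :
    (∃ c, IsAlternatingHamilton (factor i) (factor j) 28 c) ∨
      ∃ c, IsAlternatingHamilton (factor j) (factor i) 28 c := by
  rcases Nat.lt_or_ge (j - i) 28 with h | h
  · have := exists_isAlternatingHamilton_factor_add (d := j - i) (by omega) h i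
    rw [Nat.sub_add_cancel hij.le] at this
    exact .inl this
  · have := exists_isAlternatingHamilton_factor_add (d := 54 - (j - i)) (by omega) (by omega) j
    rw [show 54 - (j - i) + j = i + 54 by omega, factor_add_period] at this
    exact .inr this

theorem disjoint_and_isHamiltonCycleEdgeSet {i j : ℕ} (hi : i ≤ 53) (hj : j ≤ 53)
    (hij : i ≠ j) : Disjoint (factor i) (factor j) ∧
      IsHamiltonCycleEdgeSet (completeGraph Vertex) ↑(factor i ∪ factor j) := by
  have hF := isPerfectMatchingOn_factor
  have key : (∃ c, IsAlternatingHamilton (factor i) (factor j) 28 c) ∨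
      ∃ c, IsAlternatingHamilton (factor j) (factor i) 28 c := by
    rcases Nat.lt_or_gt_of_ne hij with h | h
    · exact exists_isAlternatingHamilton_factor h hj
    · exact (exists_isAlternatingHamilton_factor h hi).symm
  rcases key with ⟨c, h⟩ | ⟨c, h⟩
  · exact ⟨h.disjoint (by omega) (hF i) (hF j),
      h.isHamiltonCycleEdgeSet (by omega) (hF i) (hF j)⟩
  · refine ⟨(h.disjoint (by omega) (hF j) (hF i)).symm, ?_⟩
    rw [Finset.union_comm]
    exact h.isHamiltonCycleEdgeSet (by omega) (hF j) (hF i)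

/-- `e` lies in one of the factors of the factorisation. -/
def Covered (e : Sym2 Vertex) : Prop := e ∈ antipodalFactor ∨ ∃ i ≤ 53, e ∈ factor i

theorem covered_of_mem_factor {e : Sym2 Vertex} {i : ℕ} (he : e ∈ factor i) : Covered e := by
  refine .inr ⟨i % 54, by omega, ?_⟩
  rwa [factor, rotation_iterate, ZMod.natCast_mod, ← rotation_iterate, ← factor]

theorem Covered.map {e : Sym2 Vertex} (he : Covered e) (j : ℕ) :
    Covered (e.map (rotation^[j])) := by
  rcases he with he | ⟨i, -, he⟩
  · left
    rw [← image_antipodalFactor j]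
    exact Finset.mem_image_of_mem _ he
  · apply covered_of_mem_factor (i := i + j)
    rw [← image_factor]
    exact Finset.mem_image_of_mem _ he

theorem covered_mk_zero {v : Vertex} (hv : v ≠ .inl 0) : Covered s(.inl 0, v) := by
  have key : ∀ x < 56, x = 0 ∨ x = 27 ∨
      ∃ i < 54, partner (shift (54 - i) 0) = shift (54 - i) x := by
    decide +kernel
  obtain ⟨x, hx, rfl⟩ := exists_vertex_eq v
  rcases key x hx with rfl | rfl | ⟨i, hi, h⟩
  · exact absurd rfl hv
  · exact .inl (by decide +kernel)
  · exact .inr ⟨i, by omega, mem_factor_of_partner (by omega) (by omega) h⟩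

theorem covered_mk_inl (x : ZMod 54) {v : Vertex} (hv : v ≠ .inl x) :
    Covered s(.inl x, v) := by
  obtain ⟨w, rfl⟩ := (bijective_rotation_iterate x.val).surjective v
  have hx : rotation^[x.val] (.inl 0) = .inl x := by
    simp [rotation_iterate]
  have h := (covered_mk_zero (v := w) fun h => hv (by rw [h, hx])).map x.val
  rwa [Sym2.map_mk, hx] at h

theorem covered_of_not_isDiag {e : Sym2 Vertex} (he : ¬ e.IsDiag) : Covered e := by
  induction e using Sym2.ind with
  | _ u v =>
  rw [Sym2.mk_isDiag_iff] at he
  rcases u with x | x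
  · exact covered_mk_inl x (Ne.symm he)
  rcases v with y | y
  · rw [Sym2.eq_swap]
    exact covered_mk_inl y he
  left
  revert x y
  decide +kernel

end EvenStarter

open EvenStarter in
/-- On the 56 vertices `ℤ₅₄ ⊕ {∞₁, ∞₂}` (with `∞₁ = Sum.inr 0` and `∞₂ = Sum.inr 1`), the
family `{M, F 0, F 1, …, F 53}` obtained from the even starter `ES` is a perfect
1-factorisation of the complete graph `K₅₆`: each member is a perfect matching, they are
pairwise edge-disjoint, their union is the entire edge set, and the union of any two distinct
members is the edge set of a Hamilton cycle.  Here `σ` is the permutation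
`(0, 1, …, 53)(∞₁)(∞₂)`. -/
theorem perfect_one_factorisation_K56_from_even_starter :
    let V := ZMod 54 ⊕ Fin 2
    let σ : V → V := Sum.map (· + 1) id
    let F₀ : Finset (Sym2 V) :=
      ES.image (Sym2.map Sum.inl) ∪ {s(Sum.inl 9, Sum.inr 0), s(Sum.inl 47, Sum.inr 1)}
    let F : ℕ → Finset (Sym2 V) := fun i => F₀.image (Sym2.map (σ^[i]))
    let M : Finset (Sym2 V) :=
      (Finset.range 27).image (fun (x : ℕ) =>
        s(Sum.inl (x : ZMod 54), Sum.inl ((x + 27 : ℕ) : ZMod 54)))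
        ∪ {s(Sum.inr 0, Sum.inr 1)}
    IsPerfectMatchingOn M ∧
    (∀ i ≤ 53, IsPerfectMatchingOn (F i)) ∧
    (∀ i ≤ 53, Disjoint M (F i)) ∧
    (∀ i j, i ≤ 53 → j ≤ 53 → i ≠ j → Disjoint (F i) (F j)) ∧
    (∀ e : Sym2 V, ¬ e.IsDiag ↔ (e ∈ M ∨ ∃ i ≤ 53, e ∈ F i)) ∧
    (∀ i ≤ 53, IsHamiltonCycleEdgeSet (completeGraph V) ↑(M ∪ F i)) ∧
    (∀ i j, i ≤ 53 → j ≤ 53 → i ≠ j →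
      IsHamiltonCycleEdgeSet (completeGraph V) ↑(F i ∪ F j)) := by
  intro V σ F₀ F M
  have hM : IsPerfectMatchingOn M := isPerfectMatchingOn_antipodalFactor
  have hF : ∀ i, IsPerfectMatchingOn (F i) := isPerfectMatchingOn_factor
  have hMF : ∀ i, ∃ c, IsAlternatingHamilton (F i) M 28 c :=
    exists_isAlternatingHamilton_antipodalFactor
  refine ⟨hM, fun i _ => hF i, fun i _ => ?_, fun i j hi hj hij => ?_, fun e => ⟨?_, ?_⟩,
    fun i _ => ?_, fun i j hi hj hij => ?_⟩
  · obtain ⟨c, h⟩ := hMF i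
    exact (h.disjoint (by omega) (hF i) hM).symm
  · exact (disjoint_and_isHamiltonCycleEdgeSet hi hj hij).1
  · exact covered_of_not_isDiag
  · rintro (he | ⟨i, -, he⟩)
    · exact hM.1 e he
    · exact (hF i).1 e he
  · obtain ⟨c, h⟩ := hMF i
    rw [Finset.union_comm]
    exact h.isHamiltonCycleEdgeSet (by omega) (hF i) hM
  · exact (disjoint_and_isHamiltonCycleEdgeSet hi hj hij).2
end
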